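/- The zig-zag distance δ on Harm is a pseudometric: it is symmetric, δ(q,q)=0, satisfies the triangle inequality δ(q,q'') ≤ δ(q,q') + δ(q',q''), and is finite for all q,q',q'' ∈ Harm. -/

import Mathlib

open scoped Classical

section Mobius

variable {X : Type*}

/-- The pairs `(x,y)` and `(z,u)` separate each other on the circularly ordered set `X`:
`z` and `u` lie on different open arcs determined by `x` and `y`. -/
def PairSeparates [CircularOrder X] (x y z u : X) : Prop :=
  (sbtw x z y ∧ sbtw y u x) ∨ (sbtw x u y ∧ sbtw y z x)

/-- The pair `(d₁,d₂)` separates the pairs `(b₁,b₂)` and `(c₁,c₂)`: the latter two pairs lie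
on different open arcs determined by `(d₁,d₂)`. -/
def ArcSepPairs [CircularOrder X] (d₁ d₂ b₁ b₂ c₁ c₂ : X) : Prop :=
  (sbtw d₁ b₁ d₂ ∧ sbtw d₁ b₂ d₂ ∧ sbtw d₂ c₁ d₁ ∧ sbtw d₂ c₂ d₁) ∨
  (sbtw d₁ c₁ d₂ ∧ sbtw d₁ c₂ d₂ ∧ sbtw d₂ b₁ d₁ ∧ sbtw d₂ b₂ d₁)

/-- Two pairs `(b₁,b₂)` and `(c₁,c₂)` of points are in the strong causal relation:
either of them lies entirely in one open arc determined by the other. -/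
def StrongCausal [CircularOrder X] (b₁ b₂ c₁ c₂ : X) : Prop :=
  (sbtw b₁ c₁ b₂ ∧ sbtw b₁ c₂ b₂) ∨ (sbtw b₂ c₁ b₁ ∧ sbtw b₂ c₂ b₁) ∨
  (sbtw c₁ b₁ c₂ ∧ sbtw c₁ b₂ c₂) ∨ (sbtw c₂ b₁ c₁ ∧ sbtw c₂ b₂ c₁)

/-- The topology generated by open balls of the semi-metrics with infinitely remote points,
centered at finite points. `D ω x y` denotes `|xy|` in the semi-metric with infinitely remote
point `ω`. -/
def MTopology (D : X → X → X → ℝ) : TopologicalSpace X :=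
  TopologicalSpace.generateFrom
    {s | ∃ ω x r, x ≠ ω ∧ s = {y | y ≠ ω ∧ D ω x y < r}}

/-- A (ptolemaic) monotone Möbius structure on a circle `X`, presented by the family of its
semi-metrics with infinitely remote points: `D ω x y` is the distance `|xy|_ω` in the
semi-metric with infinitely remote point `ω` (defined for `x, y ≠ ω`).  The semi-metrics
are pairwise related by metric inversion (up to homothety), every one of them satisfies the
Ptolemy inequality, the monotonicity axiom (M) holds, the M-topology is the given topology
of `X`, and `X` is homeomorphic to the circle. -/
structure MonotoneMobius (X : Type*) [CircularOrder X] [t : TopologicalSpace X] where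
  D : X → X → X → ℝ
  symm : ∀ ω x y, D ω x y = D ω y x
  refl : ∀ ω x, D ω x x = 0
  pos : ∀ ω x y, x ≠ y → x ≠ ω → y ≠ ω → 0 < D ω x y
  inversion : ∀ ω ω', ω ≠ ω' → ∃ c : ℝ, 0 < c ∧ ∀ x y, x ≠ ω → y ≠ ω → x ≠ ω' → y ≠ ω' →
    D ω' x y = c * D ω x y / (D ω x ω' * D ω y ω')
  ptolemy : ∀ ω x y z u, x ≠ ω → y ≠ ω → z ≠ ω → u ≠ ω →
    D ω x y * D ω z u ≤ D ω x z * D ω y u + D ω x u * D ω y z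
  mono : ∀ ω x y z u, x ≠ ω → y ≠ ω → z ≠ ω → u ≠ ω → PairSeparates x y z u →
    D ω x z * D ω y u < D ω x y * D ω z u ∧ D ω x u * D ω y z < D ω x y * D ω z u
  mtop : MTopology D = t
  circle : Nonempty (X ≃ₜ AddCircle (1 : ℝ))

variable [CircularOrder X] [TopologicalSpace X]

/-- The 4-tuple `(x,y,z,u)` is harmonic (of the first type): `|xz||yu| = |xu||yz|` in any
semi-metric of the Möbius structure. -/
def MonotoneMobius.Harmonic (M : MonotoneMobius X) (x y z u : X) : Prop :=
  ∀ ω, ω ≠ x → ω ≠ y → ω ≠ z → ω ≠ u →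
    M.D ω x z * M.D ω y u = M.D ω x u * M.D ω y z

/-- The distance `|q q'| = |ln ((|xp'||yp|)/(|xp||yp'|))|` between two harmonic pairs
`q = ((x,y),(p,·))` and `q' = ((x,y),(p',·))` with common axis `(x,y)`; computed here in the
semi-metric with infinitely remote point `x`, where it equals `|ln (|yp|_x / |yp'|_x)|`. -/
noncomputable def MonotoneMobius.lineDist (M : MonotoneMobius X) (x y p p' : X) : ℝ :=
  |Real.log (M.D x y p / M.D x y p')|

end Mobius

section Harm

variable {X : Type*} [CircularOrder X] [TopologicalSpace X]

/-- A point of the space `Harm`: a harmonic pair `((x,y),(z,u))` of pairs of distinct points,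
with left axis `(x,y)` and right axis `(z,u)` (the entries of each axis being unordered). -/
structure HarmPt (M : MonotoneMobius X) where
  x : X
  y : X
  z : X
  u : X
  hxy : x ≠ y
  hxz : x ≠ z
  hxu : x ≠ u
  hyz : y ≠ z
  hyu : y ≠ u
  hzu : z ≠ u
  harm : M.Harmonic x y z u

variable {M : MonotoneMobius X}

/-- `q` and `q'` have the same left axis (as unordered pairs), i.e. lie on a common left line. -/
def leftAxisEq (q q' : HarmPt M) : Prop :=
  (q.x = q'.x ∧ q.y = q'.y) ∨ (q.x = q'.y ∧ q.y = q'.x)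

/-- `q` and `q'` have the same right axis (as unordered pairs), i.e. lie on a common right line. -/
def rightAxisEq (q q' : HarmPt M) : Prop :=
  (q.z = q'.z ∧ q.u = q'.u) ∨ (q.z = q'.u ∧ q.u = q'.z)

/-- The length of the left segment from `q` to `q'` (lying on a common left line). -/
noncomputable def stepDistL (q q' : HarmPt M) : ℝ := M.lineDist q.x q.y q.z q'.z

/-- The length of the right segment from `q` to `q'` (lying on a common right line). -/
noncomputable def stepDistR (q q' : HarmPt M) : ℝ := M.lineDist q.z q.u q.x q'.x

/-- `ZZ q q' b n L` : there is a zig-zag path from `q` to `q'` with `n` sides of total length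
`L`, alternating between left and right segments, whose first side is a left segment if
`b = true` and a right segment if `b = false`; sides are nondegenerate (they join distinct
points of `Harm`). -/
inductive ZZ : HarmPt M → HarmPt M → Bool → ℕ → ℝ → Prop
  | nil (q : HarmPt M) (b : Bool) : ZZ q q b 0 0
  | left {q q' qe : HarmPt M} {n : ℕ} {L : ℝ} (hne : ¬ rightAxisEq q q')
      (hax : leftAxisEq q q') (rest : ZZ q' qe false n L) :
      ZZ q qe true (n + 1) (stepDistL q q' + L)
  | right {q q' qe : HarmPt M} {n : ℕ} {L : ℝ} (hne : ¬ leftAxisEq q q')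
      (hax : rightAxisEq q q') (rest : ZZ q' qe true n L) :
      ZZ q qe false (n + 1) (stepDistR q q' + L)

/-- The zig-zag distance `δ(q,q')`: the infimum of the lengths of zig-zag paths from `q` to
`q'` (`⊤` if there is none). -/
noncomputable def zzDist (q q' : HarmPt M) : ENNReal :=
  sInf {e : ENNReal | ∃ (r : ℝ) (b : Bool) (n : ℕ), ZZ q q' b n r ∧ e = ENNReal.ofReal r}

end Harm

namespace MonotoneMobius

variable {X : Type*} [CircularOrder X] [TopologicalSpace X]

theorem infinite (M : MonotoneMobius X) : Infinite X := by
  obtain ⟨φ⟩ := M.circle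
  have : Infinite (Set.Ico (0 : ℝ) (0 + 1)) := (Set.Ico_infinite (by norm_num)).to_subtype
  have : Infinite (AddCircle (1 : ℝ)) :=
    Infinite.of_injective _ (AddCircle.equivIco (1 : ℝ) 0).symm.injective
  exact φ.toEquiv.infinite_iff.2 this

theorem exists_ne_of_four (M : MonotoneMobius X) (a b c d : X) :
    ∃ ω, ω ≠ a ∧ ω ≠ b ∧ ω ≠ c ∧ ω ≠ d := by
  have := M.infinite
  obtain ⟨ω, h⟩ := Infinite.exists_notMem_finset ({a, b, c, d} : Finset X)
  simp only [Finset.mem_insert, Finset.mem_singleton, not_or] at h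
  exact ⟨ω, h⟩

variable (M : MonotoneMobius X)

theorem Harmonic.swap_pairs {x y z u : X} (h : M.Harmonic x y z u) : M.Harmonic z u x y := by
  intro ω h1 h2 h3 h4
  have := h ω h3 h4 h1 h2
  rw [M.symm ω z x, M.symm ω u y, M.symm ω z y, M.symm ω u x]
  linarith

theorem Harmonic.swap_left {x y z u : X} (h : M.Harmonic x y z u) : M.Harmonic y x z u := by
  intro ω h1 h2 h3 h4
  have := h ω h2 h1 h3 h4
  linarith

theorem Harmonic.swap_right {x y z u : X} (h : M.Harmonic x y z u) : M.Harmonic x y u z := by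
  intro ω h1 h2 h3 h4
  have := h ω h1 h2 h4 h3
  linarith

theorem harmonic_of_remote {ω x y z u : X} (hx : x ≠ ω) (hy : y ≠ ω) (hz : z ≠ ω) (hu : u ≠ ω)
    (h : M.D ω x z * M.D ω y u = M.D ω x u * M.D ω y z) : M.Harmonic x y z u := by
  intro ω' h1 h2 h3 h4
  by_cases hω : ω = ω'
  · subst hω; exact h
  obtain ⟨c, hc, hD⟩ := M.inversion ω ω' hω
  have px := M.pos ω x ω' h1.symm hx (Ne.symm hω)
  have py := M.pos ω y ω' h2.symm hy (Ne.symm hω)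
  have pz := M.pos ω z ω' h3.symm hz (Ne.symm hω)
  have pu := M.pos ω u ω' h4.symm hu (Ne.symm hω)
  rw [hD x z hx hz h1.symm h3.symm, hD y u hy hu h2.symm h4.symm,
    hD x u hx hu h1.symm h4.symm, hD y z hy hz h2.symm h3.symm]
  field_simp
  linear_combination h

theorem harmonic_iff_remote_mem {x y z u : X} (hxy : x ≠ y) (hxz : x ≠ z) (hxu : x ≠ u) :
    M.Harmonic x y z u ↔ M.D x y z = M.D x y u := by
  obtain ⟨ω, h1, h2, h3, h4⟩ := M.exists_ne_of_four x y z u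
  obtain ⟨c, hc, hD⟩ := M.inversion ω x h1
  have py := M.pos ω y x hxy.symm h2.symm h1.symm
  have pz := M.pos ω z x hxz.symm h3.symm h1.symm
  have pu := M.pos ω u x hxu.symm h4.symm h1.symm
  rw [hD y z h2.symm h3.symm hxy.symm hxz.symm, hD y u h2.symm h4.symm hxy.symm hxu.symm]
  have key : c * M.D ω y z / (M.D ω y x * M.D ω z x) = c * M.D ω y u / (M.D ω y x * M.D ω u x) ↔
      M.D ω x z * M.D ω y u = M.D ω x u * M.D ω y z := by
    rw [div_eq_div_iff (by positivity) (by positivity), M.symm ω x z, M.symm ω x u]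
    constructor
    · intro h
      have : c * M.D ω y x * (M.D ω z x * M.D ω y u - M.D ω u x * M.D ω y z) = 0 := by
        linear_combination -h
      have h0 : c * M.D ω y x ≠ 0 := by positivity
      linarith [(mul_eq_zero.1 this).resolve_left h0]
    · intro h
      linear_combination -(c * M.D ω y x) * h
  rw [key]
  exact ⟨fun h => h ω h1 h2 h3 h4,
    fun h => M.harmonic_of_remote h1.symm h2.symm h3.symm h4.symm h⟩

theorem triangle {ω x y z : X} (hx : x ≠ ω) (hy : y ≠ ω) (hz : z ≠ ω) :
    M.D ω x y ≤ M.D ω x z + M.D ω z y := by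
  by_cases hxz : x = z
  · subst hxz; simp [M.refl]
  by_cases hyz : y = z
  · subst hyz; simp [M.refl]
  obtain ⟨ω', h1, h2, h3, h4⟩ := M.exists_ne_of_four x y z ω
  obtain ⟨c, hc, hD⟩ := M.inversion ω' ω h4
  have px := M.pos ω' x ω hx h1.symm h4.symm
  have py := M.pos ω' y ω hy h2.symm h4.symm
  have pz := M.pos ω' z ω hz h3.symm h4.symm
  have hp := M.ptolemy ω' x y z ω h1.symm h2.symm h3.symm h4.symm
  rw [hD x y h1.symm h2.symm hx hy, hD x z h1.symm h3.symm hx hz, hD z y h3.symm h2.symm hz hy]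
  have e : c * M.D ω' x z / (M.D ω' x ω * M.D ω' z ω) + c * M.D ω' z y / (M.D ω' z ω * M.D ω' y ω)
      = c * (M.D ω' x z * M.D ω' y ω + M.D ω' x ω * M.D ω' y z) /
        (M.D ω' x ω * M.D ω' y ω * M.D ω' z ω) := by
    rw [M.symm ω' z y]; field_simp
  have e' : c * M.D ω' x y / (M.D ω' x ω * M.D ω' y ω) = c * (M.D ω' x y * M.D ω' z ω) /
        (M.D ω' x ω * M.D ω' y ω * M.D ω' z ω) := by
    field_simp
  rw [e, e']
  gcongr

theorem dist_lt_of_separates {ω x y z : X} (hx : x ≠ ω) (hy : y ≠ ω) (hz : z ≠ ω)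
    (h : PairSeparates x y z ω) : M.D ω x z < M.D ω x y ∧ M.D ω z y < M.D ω x y := by
  obtain ⟨ω', h1, h2, h3, h4⟩ := M.exists_ne_of_four x y z ω
  obtain ⟨c, hc, hD⟩ := M.inversion ω' ω h4
  have px := M.pos ω' x ω hx h1.symm h4.symm
  have py := M.pos ω' y ω hy h2.symm h4.symm
  have pz := M.pos ω' z ω hz h3.symm h4.symm
  have hp := M.mono ω' x y z ω h1.symm h2.symm h3.symm h4.symm h
  rw [hD x y h1.symm h2.symm hx hy, hD x z h1.symm h3.symm hx hz, hD z y h3.symm h2.symm hz hy]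
  rw [div_lt_div_iff₀ (by positivity) (by positivity), div_lt_div_iff₀ (by positivity) (by positivity)]
  rw [M.symm ω' z y]
  constructor
  · have := mul_lt_mul_of_pos_left hp.1 (mul_pos hc px)
    linarith
  · have := mul_lt_mul_of_pos_left hp.2 (mul_pos hc py)
    linarith

theorem lineDist_eq_abs_sub {x y p p' : X} (hxy : x ≠ y) (hxp : x ≠ p) (hyp : y ≠ p)
    (hxp' : x ≠ p') (hyp' : y ≠ p') :
    M.lineDist x y p p' = |Real.log (M.D x y p) - Real.log (M.D x y p')| := by
  rw [MonotoneMobius.lineDist, Real.log_div (M.pos x y p hyp hxy.symm hxp.symm).ne'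
    (M.pos x y p' hyp' hxy.symm hxp'.symm).ne']

theorem lineDist_eq_remote {ω x y p p' : X} (hxy : x ≠ y) (hxp : x ≠ p) (hyp : y ≠ p)
    (hxp' : x ≠ p') (hyp' : y ≠ p') (hx : x ≠ ω) (hy : y ≠ ω) (hp : p ≠ ω) (hp' : p' ≠ ω) :
    M.lineDist x y p p' = |(Real.log (M.D ω y p) - Real.log (M.D ω x p)) -
      (Real.log (M.D ω y p') - Real.log (M.D ω x p'))| := by
  rw [M.lineDist_eq_abs_sub hxy hxp hyp hxp' hyp']
  obtain ⟨c, hc, hD⟩ := M.inversion ω x hx.symm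
  have p1 := M.pos ω y x hxy.symm hy hx
  have p2 := M.pos ω x p hxp hx hp
  have p3 := M.pos ω x p' hxp' hx hp'
  have p4 := M.pos ω y p hyp hy hp
  have p5 := M.pos ω y p' hyp' hy hp'
  rw [hD y p hy hp hxy.symm hxp.symm, hD y p' hy hp' hxy.symm hxp'.symm, M.symm ω p x,
    M.symm ω p' x, Real.log_div (by positivity) (by positivity),
    Real.log_div (by positivity) (by positivity), Real.log_mul (by positivity) (by positivity),
    Real.log_mul (by positivity) (by positivity), Real.log_mul (by positivity) (by positivity),
    Real.log_mul (by positivity) (by positivity)]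
  congr 1
  ring

theorem lineDist_swap {x y p p' : X} (hxy : x ≠ y) (hxp : x ≠ p) (hyp : y ≠ p)
    (hxp' : x ≠ p') (hyp' : y ≠ p') : M.lineDist y x p p' = M.lineDist x y p p' := by
  obtain ⟨ω, h1, h2, h3, h4⟩ := M.exists_ne_of_four x y p p'
  rw [M.lineDist_eq_remote hxy hxp hyp hxp' hyp' h1.symm h2.symm h3.symm h4.symm,
    M.lineDist_eq_remote hxy.symm hyp hxp hyp' hxp' h2.symm h1.symm h3.symm h4.symm,
    ← abs_neg]
  congr 1
  ring

theorem isOpen_ball {ω x : X} (hx : x ≠ ω) (r : ℝ) : IsOpen {y | y ≠ ω ∧ M.D ω x y < r} := by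
  have h : @IsOpen X (MTopology M.D) {y | y ≠ ω ∧ M.D ω x y < r} :=
    TopologicalSpace.isOpen_generateFrom_of_mem ⟨ω, x, r, hx, rfl⟩
  rwa [M.mtop] at h

theorem continuous_dist {T : Type*} [TopologicalSpace T] {ω : X} {f : T → X}
    (hf : Continuous f) (hω : ∀ t, f t ≠ ω) :
    Continuous fun p : T × T => M.D ω (f p.1) (f p.2) := by
  rw [continuous_iff_continuousAt]
  rintro ⟨a, b⟩
  rw [ContinuousAt, Metric.tendsto_nhds]
  intro ε hε
  have key : ∀ a : T, ∀ᶠ t in nhds a, M.D ω (f a) (f t) < ε / 2 := by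
    intro a
    have : IsOpen (f ⁻¹' {y | y ≠ ω ∧ M.D ω (f a) y < ε / 2}) :=
      (M.isOpen_ball (hω a) _).preimage hf
    filter_upwards [this.mem_nhds ⟨hω a, by rw [M.refl]; positivity⟩] with t ht using ht.2
  rw [nhds_prod_eq]
  filter_upwards [(key a).prod_mk (key b)] with ⟨s, t⟩ ⟨h1, h2⟩
  simp only at h1 h2
  rw [Real.dist_eq, abs_lt]
  have t1 := M.triangle (hω a) (hω b) (hω s)
  have t2 := M.triangle (hω s) (hω b) (hω t)
  have t3 := M.triangle (hω s) (hω t) (hω a)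
  have t4 := M.triangle (hω a) (hω t) (hω b)
  rw [M.symm ω (f t) (f b)] at t2
  rw [M.symm ω (f s) (f a)] at t3
  constructor <;> linarith

end MonotoneMobius

section Chart

variable {X : Type*} [CircularOrder X] [TopologicalSpace X]

/-- A parametrization of the complement of `ω` by the real line, up to orientation. -/
structure MobiusChart (M : MonotoneMobius X) (ω : X) where
  e : ℝ → X
  inj : Function.Injective e
  ne : ∀ s, e s ≠ ω
  surj : ∀ p, p ≠ ω → ∃ s, e s = p
  cont : Continuous fun p : ℝ × ℝ => M.D ω (e p.1) (e p.2)
  lt_outer : ∀ {s t r : ℝ}, s < t → t < r →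
    M.D ω (e s) (e t) < M.D ω (e s) (e r) ∧ M.D ω (e t) (e r) < M.D ω (e s) (e r)
  lt_cross : ∀ {s t r q : ℝ}, s < t → t < r → r < q →
    M.D ω (e s) (e t) * M.D ω (e r) (e q) < M.D ω (e s) (e r) * M.D ω (e t) (e q) ∧
    M.D ω (e s) (e q) * M.D ω (e t) (e r) < M.D ω (e s) (e r) * M.D ω (e t) (e q)

namespace MobiusChart

variable {M : MonotoneMobius X} {ω : X}

/-- The chart with the opposite orientation. -/
def neg (c : MobiusChart M ω) : MobiusChart M ω where
  e s := c.e (-s)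
  inj := c.inj.comp neg_injective
  ne s := c.ne _
  surj p hp := by
    obtain ⟨s, hs⟩ := c.surj p hp
    exact ⟨-s, by simpa using hs⟩
  cont := c.cont.comp (f := fun p : ℝ × ℝ => (-p.1, -p.2)) (by fun_prop)
  lt_outer {s t r} h1 h2 := by
    have := c.lt_outer (neg_lt_neg h2) (neg_lt_neg h1)
    rw [M.symm ω (c.e (-r)) (c.e (-t)), M.symm ω (c.e (-t)) (c.e (-s)),
      M.symm ω (c.e (-r)) (c.e (-s))] at this
    exact this.symm
  lt_cross {s t r q} h1 h2 h3 := by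
    have := c.lt_cross (neg_lt_neg h3) (neg_lt_neg h2) (neg_lt_neg h1)
    rw [M.symm ω (c.e (-q)) (c.e (-r)), M.symm ω (c.e (-t)) (c.e (-s)),
      M.symm ω (c.e (-q)) (c.e (-t)), M.symm ω (c.e (-r)) (c.e (-s)),
      M.symm ω (c.e (-q)) (c.e (-s)), M.symm ω (c.e (-r)) (c.e (-t))] at this
    constructor <;> linarith [this.1, this.2]

end MobiusChart

theorem MonotoneMobius.exists_continuous_param (M : MonotoneMobius X) (ω : X) :
    ∃ e : ℝ → X, Function.Injective e ∧ Continuous e ∧ (∀ s, e s ≠ ω) ∧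
      ∀ p, p ≠ ω → ∃ s, e s = p := by
  obtain ⟨φ⟩ := M.circle
  obtain ⟨a, ha⟩ := QuotientAddGroup.mk_surjective (φ ω)
  have ha : (a : AddCircle (1 : ℝ)) = φ ω := ha
  have : Fact ((0 : ℝ) < 1) := ⟨one_pos⟩
  let f : ℝ → ℝ := fun s => a + (Real.arctan s + Real.pi / 2) / Real.pi
  have hf : ∀ s, f s ∈ Set.Ioo a (a + 1) := by
    intro s
    have h1 := Real.neg_pi_div_two_lt_arctan s
    have h2 := Real.arctan_lt_pi_div_two s
    have h3 := Real.pi_pos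
    constructor
    · have : 0 < (Real.arctan s + Real.pi / 2) / Real.pi := div_pos (by linarith) h3
      simp only [f]; linarith
    · have : (Real.arctan s + Real.pi / 2) / Real.pi < 1 := (div_lt_one h3).2 (by linarith)
      simp only [f]; linarith
  let g := AddCircle.openPartialHomeomorphCoe (1 : ℝ) a
  have hinj : Set.InjOn (fun t : ℝ => (t : AddCircle (1 : ℝ))) (Set.Ioo a (a + 1)) := g.injOn
  refine ⟨fun s => φ.symm (f s), ?_, ?_, ?_, ?_⟩
  · intro s t hst
    have := hinj (hf s) (hf t) (φ.symm.injective hst)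
    have h3 := Real.pi_pos
    simp only [f] at this
    apply Real.arctan_injective
    field_simp at this
    linarith
  · refine φ.symm.continuous.comp ((AddCircle.continuous_mk' 1).comp ?_)
    have := Real.continuous_arctan
    have h3 := Real.pi_pos.ne'
    fun_prop
  · intro s hs
    have h : ((f s : ℝ) : AddCircle (1 : ℝ)) = a := by
      rw [ha, ← hs, Homeomorph.apply_symm_apply]
    have := g.map_source (hf s)
    exact this h
  · intro p hp
    have hp' : φ p ∈ g.target := by
      change φ p ∈ ({(a : AddCircle (1 : ℝ))}ᶜ : Set _)
      rw [ha]
      simpa using hp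
    have h1 : g.symm (φ p) ∈ Set.Ioo a (a + 1) := g.map_target hp'
    have h2 : ((g.symm (φ p) : ℝ) : AddCircle (1 : ℝ)) = φ p := g.right_inv hp'
    set b := g.symm (φ p)
    have h3 := Real.pi_pos
    refine ⟨Real.tan ((b - a) * Real.pi - Real.pi / 2), ?_⟩
    have : f (Real.tan ((b - a) * Real.pi - Real.pi / 2)) = b := by
      simp only [f]
      rw [Real.arctan_tan]
      · field_simp; ring
      · have := mul_pos (sub_pos.2 h1.1) h3
        linarith
      · have := mul_lt_mul_of_pos_right (show b - a < 1 by linarith [h1.2]) h3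
        linarith
    beta_reduce
    rw [this, h2, Homeomorph.symm_apply_apply]

theorem sbtw_total_of_ne {Y : Type*} [CircularOrder Y] {a b c : Y} (hab : a ≠ b) (hbc : b ≠ c) (hca : c ≠ a) :
    sbtw a b c ∨ sbtw a c b := by
  by_contra h
  push Not at h
  have h1 := btw_iff_not_sbtw.2 h.1
  have h2 := (btw_iff_not_sbtw.2 h.2)
  rcases h1.antisymm h2.cyclic_left.cyclic_left with h | h | h
  · exact hbc h.symm
  · exact hab h.symm
  · exact hca h.symm

theorem sbtw_trans_of_sbtw {Y : Type*} [CircularOrder Y] {a b c d : Y} (h1 : sbtw a b c) (h2 : sbtw a c d) : sbtw b c d := by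
  exact (SBtw.sbtw.trans_left h2.cyclic_right h1).cyclic_left

/-- A linear orientation of a continuously parametrized punctured circle agrees with the circular
order or with its opposite. -/
theorem MonotoneMobius.orientation_dichotomy (M : MonotoneMobius X) {ω : X} {e : ℝ → X}
    (hinj : Function.Injective e) (hcont : Continuous e) (hne : ∀ s, e s ≠ ω) :
    (∀ s t, s < t → sbtw ω (e s) (e t)) ∨ ∀ s t, s < t → sbtw ω (e t) (e s) := by
  have hd := M.continuous_dist hcont hne
  have hopen : IsOpen {p : ℝ × ℝ | sbtw ω (e p.1) (e p.2)} := by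
    rw [isOpen_iff_mem_nhds]
    rintro ⟨s, t⟩ (hst : sbtw ω (e s) (e t))
    have hst' : e s ≠ e t := fun h => sbtw_irrefl_right (h ▸ hst)
    have hpos := M.pos ω _ _ hst' (hne s) (hne t)
    have h1 : ∀ᶠ p : ℝ × ℝ in nhds (s, t), M.D ω (e s) (e p.1) < M.D ω (e s) (e t) / 2 := by
      have : Continuous fun p : ℝ × ℝ => M.D ω (e s) (e p.1) :=
        hd.comp (f := fun p : ℝ × ℝ => (s, p.1)) (by fun_prop)
      refine this.continuousAt.eventually_lt continuousAt_const ?_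
      simp only [M.refl]; positivity
    have h2 : ∀ᶠ p : ℝ × ℝ in nhds (s, t), M.D ω (e t) (e p.2) < M.D ω (e s) (e t) / 2 := by
      have : Continuous fun p : ℝ × ℝ => M.D ω (e t) (e p.2) :=
        hd.comp (f := fun p : ℝ × ℝ => (t, p.2)) (by fun_prop)
      refine this.continuousAt.eventually_lt continuousAt_const ?_
      simp only [M.refl]; positivity
    filter_upwards [h1, h2] with ⟨s', t'⟩ h1 h2
    simp only at h1 h2
    change sbtw ω (e s') (e t')
    have k1 : sbtw ω (e s) (e t') := by
      have hne1 : e s ≠ e t' := by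
        intro h; rw [← h, M.symm ω (e t)] at h2; linarith
      by_contra hcon
      have h3 := (sbtw_total_of_ne (hne s).symm hne1 (hne t')).resolve_left hcon
      have h4 := sbtw_trans_of_sbtw h3 hst
      have := (M.dist_lt_of_separates (hne t') (hne t) (hne s)
        (Or.inl ⟨h4, (h3.trans_right hst).cyclic_right⟩)).2
      rw [M.symm ω (e t)] at h2
      linarith
    have htri := M.triangle (hne s) (hne t) (hne t')
    rw [M.symm ω (e t') (e t)] at htri
    have hne2 : e s' ≠ e t' := by
      intro h; rw [h] at h1; linarith
    by_contra hcon
    have h3 := (sbtw_total_of_ne (hne s').symm hne2 (hne t')).resolve_left hcon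
    have h4 := sbtw_trans_of_sbtw k1 h3
    have := (M.dist_lt_of_separates (hne s) (hne s') (hne t')
        (Or.inl ⟨h4, (k1.trans_right h3).cyclic_right⟩)).1
    linarith
  have hopen' : IsOpen {p : ℝ × ℝ | sbtw ω (e p.2) (e p.1)} :=
    hopen.preimage (f := fun p : ℝ × ℝ => (p.2, p.1)) (by fun_prop)
  have hconn : IsPreconnected {p : ℝ × ℝ | p.1 < p.2} := by
    apply Convex.isPreconnected
    have : {p : ℝ × ℝ | p.1 < p.2} = {p : ℝ × ℝ | (LinearMap.fst ℝ ℝ ℝ - LinearMap.snd ℝ ℝ ℝ) p < 0} := by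
      ext p; simp
    rw [this]
    exact convex_halfSpace_lt (LinearMap.isLinear _) 0
  have hdisj : Disjoint {p : ℝ × ℝ | sbtw ω (e p.1) (e p.2)}
      {p : ℝ × ℝ | sbtw ω (e p.2) (e p.1)} := by
    rw [Set.disjoint_left]
    intro p hp hp'
    exact sbtw_asymm (SBtw.sbtw.cyclic_left hp) hp'
  have hcover : {p : ℝ × ℝ | p.1 < p.2} ⊆
      {p : ℝ × ℝ | sbtw ω (e p.1) (e p.2)} ∪ {p : ℝ × ℝ | sbtw ω (e p.2) (e p.1)} := by
    rintro ⟨s, t⟩ (hst : s < t)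
    exact sbtw_total_of_ne (hne s).symm (fun h => hst.ne (hinj h)) (hne t)
  rcases hconn.subset_or_subset hopen hopen' hdisj hcover with h | h
  · exact Or.inl fun s t hst => h (a := (s, t)) hst
  · exact Or.inr fun s t hst => h (a := (s, t)) hst

theorem MonotoneMobius.nonempty_chart (M : MonotoneMobius X) (ω : X) :
    Nonempty (MobiusChart M ω) := by
  obtain ⟨e, hinj, hcont, hne, hsurj⟩ := M.exists_continuous_param ω
  have sep3 : ∀ {s t r : ℝ}, s < t → t < r → PairSeparates (e s) (e r) (e t) ω := by
    rcases M.orientation_dichotomy hinj hcont hne with h | h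
    · intro s t r h1 h2
      exact Or.inl ⟨sbtw_trans_of_sbtw (h _ _ h1) (h _ _ h2), (h _ _ (h1.trans h2)).cyclic_right⟩
    · intro s t r h1 h2
      exact Or.inr ⟨(h _ _ (h1.trans h2)).cyclic_right.cyclic_right.cyclic_right.cyclic_right,
        sbtw_trans_of_sbtw (h _ _ h2) (h _ _ h1)⟩
  have sep4 : ∀ {s t r q : ℝ}, s < t → t < r → r < q → PairSeparates (e s) (e r) (e t) (e q) := by
    rcases M.orientation_dichotomy hinj hcont hne with h | h
    · intro s t r q h1 h2 h3
      exact Or.inl ⟨sbtw_trans_of_sbtw (h _ _ h1) (h _ _ h2),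
        (sbtw_trans_of_sbtw (h _ _ (h1.trans h2)) (h _ _ h3)).cyclic_left⟩
    · intro s t r q h1 h2 h3
      exact Or.inr ⟨(sbtw_trans_of_sbtw (h _ _ h3) (h _ _ (h1.trans h2))).cyclic_right,
        sbtw_trans_of_sbtw (h _ _ h2) (h _ _ h1)⟩
  refine ⟨⟨e, hinj, hne, hsurj, M.continuous_dist hcont hne, ?_, ?_⟩⟩
  · intro s t r h1 h2
    exact M.dist_lt_of_separates (hne _) (hne _) (hne _) (sep3 h1 h2)
  · intro s t r q h1 h2 h3
    have := M.mono ω _ _ _ _ (hne s) (hne r) (hne t) (hne q) (sep4 h1 h2 h3)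
    rw [M.symm ω (e r) (e t)] at this
    exact this

end Chart

section Paths

variable {X : Type*} [CircularOrder X] [TopologicalSpace X] {M : MonotoneMobius X}

theorem leftAxisEq.refl (q : HarmPt M) : leftAxisEq q q := Or.inl ⟨rfl, rfl⟩

theorem leftAxisEq.symm {q q' : HarmPt M} (h : leftAxisEq q q') : leftAxisEq q' q := by
  rcases h with ⟨h1, h2⟩ | ⟨h1, h2⟩
  · exact Or.inl ⟨h1.symm, h2.symm⟩
  · exact Or.inr ⟨h2.symm, h1.symm⟩

theorem leftAxisEq.trans {q q' q'' : HarmPt M} (h : leftAxisEq q q') (h' : leftAxisEq q' q'') :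
    leftAxisEq q q'' := by
  rcases h with ⟨h1, h2⟩ | ⟨h1, h2⟩ <;> rcases h' with ⟨h3, h4⟩ | ⟨h3, h4⟩
  · exact Or.inl ⟨h1.trans h3, h2.trans h4⟩
  · exact Or.inr ⟨h1.trans h3, h2.trans h4⟩
  · exact Or.inr ⟨h1.trans h4, h2.trans h3⟩
  · exact Or.inl ⟨h1.trans h4, h2.trans h3⟩

theorem rightAxisEq.refl (q : HarmPt M) : rightAxisEq q q := Or.inl ⟨rfl, rfl⟩

/-- Exchanging the two axes of a harmonic pair. -/
def HarmPt.swap (q : HarmPt M) : HarmPt M where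
  x := q.z
  y := q.u
  z := q.x
  u := q.y
  hxy := q.hzu
  hxz := q.hxz.symm
  hxu := q.hyz.symm
  hyz := q.hxu.symm
  hyu := q.hyu.symm
  hzu := q.hxy
  harm := MonotoneMobius.Harmonic.swap_pairs M q.harm

theorem rightAxisEq.symm {q q' : HarmPt M} (h : rightAxisEq q q') : rightAxisEq q' q :=
  leftAxisEq.symm (q := q.swap) (q' := q'.swap) h

theorem rightAxisEq.trans {q q' q'' : HarmPt M} (h : rightAxisEq q q') (h' : rightAxisEq q' q'') :
    rightAxisEq q q'' :=
  leftAxisEq.trans (q := q.swap) (q' := q'.swap) (q'' := q''.swap) h h'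

/-- The coordinate along the left line of `q` of the harmonic pair `q'`. -/
noncomputable def leftCoord (q q' : HarmPt M) : ℝ := Real.log (M.D q.x q.y q'.z)

theorem leftAxisEq.stepDistL_eq {q q₁ q₂ : HarmPt M} (h₁ : leftAxisEq q q₁)
    (h₂ : leftAxisEq q q₂) : stepDistL q₁ q₂ = |leftCoord q q₁ - leftCoord q q₂| := by
  have key : stepDistL q₁ q₂ = M.lineDist q.x q.y q₁.z q₂.z := by
    have hx : q₁.x ≠ q₂.z ∧ q₁.y ≠ q₂.z := by
      rcases h₁.symm.trans h₂ with ⟨h, h'⟩ | ⟨h, h'⟩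
      · rw [h, h']; exact ⟨q₂.hxz, q₂.hyz⟩
      · rw [h, h']; exact ⟨q₂.hyz, q₂.hxz⟩
    rcases h₁ with ⟨h, h'⟩ | ⟨h, h'⟩
    · rw [h, h']; rfl
    · rw [h, h', M.lineDist_swap q₁.hxy q₁.hxz q₁.hyz hx.1 hx.2]; rfl
  have k1 : q.x ≠ q₁.z ∧ q.y ≠ q₁.z := by
    rcases h₁ with ⟨h, h'⟩ | ⟨h, h'⟩
    · rw [h, h']; exact ⟨q₁.hxz, q₁.hyz⟩
    · rw [h, h']; exact ⟨q₁.hyz, q₁.hxz⟩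
  have k2 : q.x ≠ q₂.z ∧ q.y ≠ q₂.z := by
    rcases h₂ with ⟨h, h'⟩ | ⟨h, h'⟩
    · rw [h, h']; exact ⟨q₂.hxz, q₂.hyz⟩
    · rw [h, h']; exact ⟨q₂.hyz, q₂.hxz⟩
  rw [key, M.lineDist_eq_abs_sub q.hxy k1.1 k1.2 k2.1 k2.2, leftCoord, leftCoord]

theorem leftAxisEq.leftCoord_eq {q q₁ q₂ : HarmPt M} (h₁ : leftAxisEq q q₁)
    (h : rightAxisEq q₁ q₂) : leftCoord q q₁ = leftCoord q q₂ := by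
  rcases h with ⟨h, -⟩ | ⟨-, h⟩
  · rw [leftCoord, leftCoord, h]
  · have hh : M.Harmonic q.x q.y q₁.z q₁.u := by
      rcases h₁ with ⟨h, h'⟩ | ⟨h, h'⟩
      · rw [h, h']; exact q₁.harm
      · rw [h, h']; exact MonotoneMobius.Harmonic.swap_left M q₁.harm
    have k : q.x ≠ q₁.z ∧ q.x ≠ q₁.u := by
      rcases h₁ with ⟨h, h'⟩ | ⟨h, h'⟩
      · rw [h]; exact ⟨q₁.hxz, q₁.hxu⟩
      · rw [h]; exact ⟨q₁.hyz, q₁.hyu⟩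
    rw [leftCoord, leftCoord, ← h, (M.harmonic_iff_remote_mem q.hxy k.1 k.2).1 hh]

theorem stepDistL_nonneg (q q' : HarmPt M) : 0 ≤ stepDistL q q' := abs_nonneg _

theorem stepDistR_nonneg (q q' : HarmPt M) : 0 ≤ stepDistR q q' := abs_nonneg _

theorem stepDistL_comm {q q' : HarmPt M} (h : leftAxisEq q q') :
    stepDistL q q' = stepDistL q' q := by
  rw [(leftAxisEq.refl q).stepDistL_eq h, h.stepDistL_eq (leftAxisEq.refl q), abs_sub_comm]

theorem stepDistL_triangle {q q' q'' : HarmPt M} (h : leftAxisEq q q') (h' : leftAxisEq q' q'') :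
    stepDistL q q'' ≤ stepDistL q q' + stepDistL q' q'' := by
  rw [(leftAxisEq.refl q).stepDistL_eq h, (leftAxisEq.refl q).stepDistL_eq (h.trans h'),
    h.stepDistL_eq (h.trans h')]
  exact abs_sub_le _ _ _

theorem stepDistL_congr_right {q q₁ q₂ : HarmPt M} (h : leftAxisEq q q₁) (hl : leftAxisEq q₁ q₂)
    (hr : rightAxisEq q₁ q₂) : stepDistL q q₁ = stepDistL q q₂ := by
  rw [(leftAxisEq.refl q).stepDistL_eq h, (leftAxisEq.refl q).stepDistL_eq (h.trans hl),
    h.leftCoord_eq hr]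

theorem stepDistL_congr_left {q₁ q₂ q : HarmPt M} (h : leftAxisEq q₁ q) (hl : leftAxisEq q₁ q₂)
    (hr : rightAxisEq q₁ q₂) : stepDistL q₁ q = stepDistL q₂ q := by
  rw [stepDistL_comm h, stepDistL_comm (hl.symm.trans h), stepDistL_congr_right h.symm hl hr]

theorem ZZ.nonneg {q q' : HarmPt M} {b : Bool} {n : ℕ} {r : ℝ} (h : ZZ q q' b n r) : 0 ≤ r := by
  induction h with
  | nil => exact le_rfl
  | left _ _ _ ih => exact add_nonneg (stepDistL_nonneg _ _) ih
  | right _ _ _ ih => exact add_nonneg (stepDistR_nonneg _ _) ih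

theorem ZZ.swap {q q' : HarmPt M} {b : Bool} {n : ℕ} {r : ℝ} (h : ZZ q q' b n r) :
    ZZ q.swap q'.swap (!b) n r := by
  induction h with
  | nil q b => exact ZZ.nil _ _
  | left hne hax _ ih => exact ZZ.right (q := HarmPt.swap _) (q' := HarmPt.swap _) hne hax ih
  | right hne hax _ ih => exact ZZ.left (q := HarmPt.swap _) (q' := HarmPt.swap _) hne hax ih

theorem ZZ.congr_start {q₁ q₂ q : HarmPt M} {b : Bool} {n : ℕ} {r : ℝ} (h : ZZ q₁ q b (n + 1) r)
    (hl : leftAxisEq q₁ q₂) (hr : rightAxisEq q₁ q₂) : ZZ q₂ q b (n + 1) r := by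
  cases h with
  | left hne hax rest =>
    rw [stepDistL_congr_left hax hl hr]
    exact ZZ.left (fun h => hne (hr.trans h)) (hl.symm.trans hax) rest
  | right hne hax rest =>
    have := stepDistL_congr_left (q₁ := q₁.swap) (q₂ := q₂.swap) (q := HarmPt.swap _) hax hr hl
    change stepDistR _ _ = stepDistR _ _ at this
    rw [this]
    exact ZZ.right (fun h => hne (hl.trans h)) (hr.symm.trans hax) rest

theorem ZZ.congr_end {q q₁ q₂ : HarmPt M} {b : Bool} {n : ℕ} {r : ℝ} (h : ZZ q q₁ b (n + 1) r)
    (hl : leftAxisEq q₁ q₂) (hr : rightAxisEq q₁ q₂) : ZZ q q₂ b (n + 1) r := by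
  induction n generalizing q b r with
  | zero =>
    cases h with
    | left hne hax rest =>
      cases rest
      rw [stepDistL_congr_right hax hl hr]
      exact ZZ.left (fun h => hne (h.trans hr.symm)) (hax.trans hl) (ZZ.nil _ _)
    | right hne hax rest =>
      cases rest
      have := stepDistL_congr_right (q := q.swap) (q₁ := q₁.swap) (q₂ := q₂.swap) hax hr hl
      change stepDistR _ _ = stepDistR _ _ at this
      rw [this]
      exact ZZ.right (fun h => hne (h.trans hl.symm)) (hax.trans hr) (ZZ.nil _ _)
  | succ n ih =>
    cases h with
    | left hne hax rest => exact ZZ.left hne hax (ih rest)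
    | right hne hax rest => exact ZZ.right hne hax (ih rest)

/-- `q` and `q'` either coincide up to the order of the entries of their axes, or are joined by a
zig-zag path of length at most `r`. -/
def JoinedWithin (q q' : HarmPt M) (r : ℝ) : Prop :=
  (∃ b n s, s ≤ r ∧ ZZ q q' b n s) ∨ (leftAxisEq q q' ∧ rightAxisEq q q' ∧ 0 ≤ r)

theorem JoinedWithin.swap {q q' : HarmPt M} {r : ℝ} (h : JoinedWithin q q' r) :
    JoinedWithin q.swap q'.swap r := by
  rcases h with ⟨b, n, s, hs, h⟩ | ⟨hl, hr, h⟩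
  · exact Or.inl ⟨_, _, s, hs, h.swap⟩
  · exact Or.inr ⟨hr, hl, h⟩

theorem JoinedWithin.refl (q : HarmPt M) : JoinedWithin q q 0 :=
  Or.inr ⟨leftAxisEq.refl q, rightAxisEq.refl q, le_rfl⟩

theorem JoinedWithin.mono {q q' : HarmPt M} {r r' : ℝ} (h : JoinedWithin q q' r) (hr : r ≤ r') :
    JoinedWithin q q' r' := by
  rcases h with ⟨b, n, s, hs, h⟩ | ⟨hl, hr', h⟩
  · exact Or.inl ⟨_, _, s, hs.trans hr, h⟩
  · exact Or.inr ⟨hl, hr', h.trans hr⟩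

theorem JoinedWithin.congr_start {q₁ q₂ q : HarmPt M} {r : ℝ} (h : JoinedWithin q₁ q r)
    (hl : leftAxisEq q₁ q₂) (hr : rightAxisEq q₁ q₂) : JoinedWithin q₂ q r := by
  rcases h with ⟨b, n, s, hs, h⟩ | ⟨hl', hr', h⟩
  · cases n with
    | zero =>
      have := h.nonneg
      cases h
      all_goals exact Or.inr ⟨hl.symm, hr.symm, this.trans hs⟩
    | succ n => exact Or.inl ⟨b, _, s, hs, h.congr_start hl hr⟩
  · exact Or.inr ⟨hl.symm.trans hl', hr.symm.trans hr', h⟩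

theorem JoinedWithin.cons_left {q q' q'' : HarmPt M} {r : ℝ} (hax : leftAxisEq q q')
    (h : JoinedWithin q' q'' r) : JoinedWithin q q'' (stepDistL q q' + r) := by
  have h0 := stepDistL_nonneg q q'
  by_cases hne : rightAxisEq q q'
  · exact (h.congr_start hax.symm hne.symm).mono (by linarith)
  rcases h with ⟨b, n, s, hs, h⟩ | ⟨hl, hr, h⟩
  · cases h with
    | nil _ b => exact Or.inl ⟨true, 1, _, by linarith, ZZ.left hne hax (ZZ.nil _ _)⟩
    | right hne' hax' rest =>
      exact Or.inl ⟨true, _, _, by linarith, ZZ.left hne hax (ZZ.right hne' hax' rest)⟩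
    | @left _ q₁ _ n L hne' hax' rest =>
      have hax₁ := hax.trans hax'
      have htri := stepDistL_triangle hax hax'
      by_cases hr : rightAxisEq q q₁
      · have hj : JoinedWithin q₁ q'' L := Or.inl ⟨_, _, L, le_rfl, rest⟩
        have := stepDistL_nonneg q' q₁
        exact (hj.congr_start hax₁.symm hr.symm).mono (by linarith)
      · exact Or.inl ⟨true, _, _, by linarith, ZZ.left hr hax₁ rest⟩
  · refine Or.inl ⟨true, 1, stepDistL q q'' + 0, ?_,
      ZZ.left (fun h' => hne (h'.trans hr.symm)) (hax.trans hl) (ZZ.nil _ _)⟩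
    rw [stepDistL_congr_right hax hl hr]
    linarith

theorem JoinedWithin.cons_right {q q' q'' : HarmPt M} {r : ℝ} (hax : rightAxisEq q q')
    (h : JoinedWithin q' q'' r) : JoinedWithin q q'' (stepDistR q q' + r) :=
  (JoinedWithin.cons_left (q := q.swap) (q' := q'.swap) (q'' := q''.swap) hax h.swap).swap

theorem JoinedWithin.trans {q q' q'' : HarmPt M} {r r' : ℝ} (h : JoinedWithin q q' r)
    (h' : JoinedWithin q' q'' r') : JoinedWithin q q'' (r + r') := by
  rcases h with ⟨b, n, s, hs, h⟩ | ⟨hl, hr, h⟩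
  · refine JoinedWithin.mono (r := s + r') ?_ (by linarith)
    clear hs
    induction h with
    | nil => simpa using h'
    | left hne hax rest ih => rw [add_assoc]; exact (ih h').cons_left hax
    | right hne hax rest ih => rw [add_assoc]; exact (ih h').cons_right hax
  · exact (h'.congr_start hl.symm hr.symm).mono (by linarith)

theorem ZZ.joinedWithin_symm {q q' : HarmPt M} {b : Bool} {n : ℕ} {r : ℝ} (h : ZZ q q' b n r) :
    JoinedWithin q' q r := by
  induction h with
  | nil q => exact JoinedWithin.refl q
  | @left q q' _ _ _ hne hax rest ih =>
    have := ih.trans ((JoinedWithin.refl q).cons_left hax.symm)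
    rwa [add_zero, stepDistL_comm hax.symm, add_comm] at this
  | @right q q' _ _ _ hne hax rest ih =>
    have := ih.trans ((JoinedWithin.refl q).cons_right hax.symm)
    have e : stepDistR q' q = stepDistR q q' :=
      stepDistL_comm (q := q'.swap) (q' := q.swap) hax.symm
    rwa [add_zero, e, add_comm] at this

theorem zzDist_le_of_zz {q q' : HarmPt M} {b : Bool} {n : ℕ} {r : ℝ} (h : ZZ q q' b n r) :
    zzDist q q' ≤ ENNReal.ofReal r :=
  sInf_le ⟨r, b, n, h, rfl⟩

/-- Zig-zag paths of arbitrarily small length joining `q` to all its relabelings make `δ` a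
pseudometric on a zig-zag connected space. -/
theorem zzDist_pseudometric
    (hloop : ∀ q q' : HarmPt M, leftAxisEq q q' → rightAxisEq q q' → ∀ ε > 0,
      ∃ b n r, r ≤ ε ∧ ZZ q q' b n r)
    (hconn : ∀ q q' : HarmPt M, ∃ r, JoinedWithin q q' r) :
    (∀ q q' : HarmPt M, zzDist q q' = zzDist q' q) ∧
    (∀ q : HarmPt M, zzDist q q = 0) ∧
    (∀ q q' q'' : HarmPt M, zzDist q q'' ≤ zzDist q q' + zzDist q' q'') ∧
    (∀ q q' : HarmPt M, zzDist q q' < ⊤) := by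
  have hle : ∀ {q q' : HarmPt M} {r : ℝ}, JoinedWithin q q' r → zzDist q q' ≤ ENNReal.ofReal r := by
    rintro q q' r (⟨b, n, s, hs, h⟩ | ⟨hl, hr, h⟩)
    · exact (zzDist_le_of_zz h).trans (ENNReal.ofReal_le_ofReal hs)
    · refine le_trans (le_of_forall_pos_le_add fun ε hε => ?_) bot_le
      rw [bot_eq_zero, zero_add]
      by_cases hε' : ε = ⊤
      · rw [hε']; exact le_top
      obtain ⟨b, n, s, hs, hz⟩ := hloop q q' hl hr ε.toReal (ENNReal.toReal_pos hε.ne' hε')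
      refine (zzDist_le_of_zz hz).trans ?_
      rw [← ENNReal.ofReal_toReal hε']
      exact ENNReal.ofReal_le_ofReal hs
  have hsymm : ∀ q q' : HarmPt M, zzDist q q' ≤ zzDist q' q := by
    intro q q'
    refine le_sInf ?_
    rintro _ ⟨r, b, n, h, rfl⟩
    exact hle h.joinedWithin_symm
  refine ⟨fun q q' => le_antisymm (hsymm q q') (hsymm q' q), ?_, ?_, ?_⟩
  · intro q
    simpa using zzDist_le_of_zz (ZZ.nil q true)
  · intro q q' q''
    conv_rhs => rw [zzDist, zzDist, ENNReal.sInf_add]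
    refine le_iInf₂ ?_
    rintro _ ⟨r, b, n, h, rfl⟩
    rw [ENNReal.add_sInf]
    refine le_iInf₂ ?_
    rintro _ ⟨r', b', n', h', rfl⟩
    rw [← ENNReal.ofReal_add h.nonneg h'.nonneg]
    have hj : JoinedWithin q q' r := Or.inl ⟨b, n, r, le_rfl, h⟩
    exact hle (hj.trans (Or.inl ⟨b', n', r', le_rfl, h'⟩))
  · intro q q'
    obtain ⟨r, h⟩ := hconn q q'
    exact (hle h).trans_lt ENNReal.ofReal_lt_top

end Paths

section Analysis

open Set

theorem exists_common_zero {f k : ℝ → ℝ → ℝ} (hf : Continuous fun p : ℝ × ℝ => f p.1 p.2)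
    (hk : Continuous fun p : ℝ × ℝ => k p.1 p.2) {α β lo hi : ℝ} (hαβ : α ≤ β) (hlh : lo ≤ hi)
    (hmono : ∀ c ∈ Icc α β, InjOn (f c) (Icc lo hi))
    (hlo : ∀ c ∈ Icc α β, f c lo ≤ 0) (hhi : ∀ c ∈ Icc α β, 0 ≤ f c hi)
    (hα : ∀ d ∈ Icc lo hi, f α d = 0 → 0 ≤ k α d)
    (hβ : ∀ d ∈ Icc lo hi, f β d = 0 → k β d ≤ 0) :
    ∃ c ∈ Icc α β, ∃ d ∈ Icc lo hi, f c d = 0 ∧ k c d = 0 := by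
  have hex : ∀ c ∈ Icc α β, ∃ d ∈ Icc lo hi, f c d = 0 := fun c hc =>
    intermediate_value_Icc hlh (f := f c)
      (hf.comp (f := fun d : ℝ => (c, d)) (by fun_prop)).continuousOn ⟨hlo c hc, hhi c hc⟩
  have hclosed : ∀ s : Set ℝ, IsClosed s →
      IsClosed (Prod.fst '' {p ∈ Icc α β ×ˢ Icc lo hi | f p.1 p.2 = 0 ∧ k p.1 p.2 ∈ s}) := by
    intro s hs
    refine (IsCompact.image ?_ continuous_fst).isClosed
    exact (isCompact_Icc.prod isCompact_Icc).inter_right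
      ((isClosed_singleton.preimage hf).inter (hs.preimage hk))
  have hconn := isPreconnected_closed_iff.1 (isPreconnected_Icc (a := α) (b := β)) _ _
    (hclosed (Ici 0) isClosed_Ici) (hclosed (Iic 0) isClosed_Iic) ?_ ?_ ?_
  · obtain ⟨c, hc, ⟨⟨c₁, d₁⟩, ⟨h₁, h₂, h₃⟩, rfl⟩, ⟨⟨c₂, d₂⟩, ⟨h₄, h₅, h₆⟩, h₇⟩⟩ := hconn
    simp only at h₇ hc h₂ h₃ h₅ h₆
    subst h₇
    have : d₁ = d₂ := hmono c₂ hc h₁.2 h₄.2 (h₂.trans h₅.symm)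
    subst this
    exact ⟨c₂, hc, d₁, h₁.2, h₂, le_antisymm h₆ h₃⟩
  · intro c hc
    obtain ⟨d, hd, h⟩ := hex c hc
    rcases le_total 0 (k c d) with h' | h'
    · exact Or.inl ⟨(c, d), ⟨⟨hc, hd⟩, h, h'⟩, rfl⟩
    · exact Or.inr ⟨(c, d), ⟨⟨hc, hd⟩, h, h'⟩, rfl⟩
  · have hc := left_mem_Icc.2 hαβ
    obtain ⟨d, hd, h⟩ := hex α hc
    exact ⟨α, hc, (α, d), ⟨⟨hc, hd⟩, h, hα d hd h⟩, rfl⟩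
  · have hc := right_mem_Icc.2 hαβ
    obtain ⟨d, hd, h⟩ := hex β hc
    exact ⟨β, hc, (β, d), ⟨⟨hc, hd⟩, h, hβ d hd h⟩, rfl⟩

theorem exists_zero_of_strictMono {h : ℝ → ℝ → ℝ} (hc : Continuous fun p : ℝ × ℝ => h p.1 p.2)
    (h₁ : ∀ t, StrictMono fun s => h s t) (h₂ : ∀ s, StrictMono (h s)) (h0 : h 0 0 = 0) {r : ℝ}
    (hr : 0 < r) : ∃ s₀, 0 < s₀ ∧ s₀ < r ∧ ∀ s, 0 < s → s ≤ s₀ → ∃ t, -r < t ∧ t < 0 ∧ h s t = 0 := by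
  have hneg : h 0 (-r) < 0 := (h₂ 0 (neg_lt_zero.2 hr)).trans_eq h0
  have hcont : Continuous fun s => h s (-r) := hc.comp (f := fun s : ℝ => (s, -r)) (by fun_prop)
  obtain ⟨δ, hδ, hball⟩ := Metric.eventually_nhds_iff.1 (hcont.continuousAt.eventually_lt_const hneg)
  have hm : 0 < min δ r := lt_min hδ hr
  refine ⟨min δ r / 2, by positivity, by linarith [min_le_right δ r], fun s hs hs' => ?_⟩
  have hs1 : h s (-r) < 0 := hball (by
    rw [Real.dist_eq, sub_zero, abs_of_pos hs]; linarith [min_le_left δ r])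
  have hs2 : 0 < h s 0 := h0.symm.trans_lt (h₁ 0 hs)
  obtain ⟨t, ht, ht'⟩ := intermediate_value_Ioo (neg_nonpos.2 hr.le) (f := h s)
    (hc.comp (f := fun d : ℝ => (s, d)) (by fun_prop)).continuousOn (show (0 : ℝ) ∈ _ from ⟨hs1, hs2⟩)
  exact ⟨t, ht.1, ht.2, ht'⟩

/-- A small quadrilateral or hexagon, with alternating sides, in the zero set of a function
of two planar variables. -/
def HasSmallLoop (O : ℝ × ℝ → ℝ × ℝ → Prop) (r : ℝ) : Prop :=
  (∃ A₁ A₂ B : ℝ × ℝ, ‖A₁‖ < r ∧ ‖A₂‖ < r ∧ ‖B‖ < r ∧ A₁ ≠ 0 ∧ A₂ ≠ 0 ∧ A₁ ≠ A₂ ∧ B ≠ 0 ∧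
    O A₁ 0 ∧ O A₂ 0 ∧ O A₁ B ∧ O A₂ B) ∨
  (∃ A₁ A₂ A₃ B₁ B₂ : ℝ × ℝ, ‖A₁‖ < r ∧ ‖A₂‖ < r ∧ ‖A₃‖ < r ∧ ‖B₁‖ < r ∧ ‖B₂‖ < r ∧
    A₁ ≠ 0 ∧ A₃ ≠ 0 ∧ A₁ ≠ A₂ ∧ A₂ ≠ A₃ ∧ B₁ ≠ 0 ∧ B₂ ≠ 0 ∧ B₁ ≠ B₂ ∧
    O A₁ 0 ∧ O A₃ 0 ∧ O A₁ B₁ ∧ O A₂ B₁ ∧ O A₂ B₂ ∧ O A₃ B₂)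

theorem norm_mk_lt {a b r : ℝ} (ha : |a| < r) (hb : |b| < r) : ‖((a, b) : ℝ × ℝ)‖ < r := by
  rw [Prod.norm_def]; exact max_lt ha hb

theorem hasSmallLoop_of_lt {g : ℝ → ℝ → ℝ → ℝ → ℝ}
    (hc : Continuous fun p : ℝ × ℝ × ℝ × ℝ => g p.1 p.2.1 p.2.2.1 p.2.2.2)
    (h₁ : ∀ b c d, StrictMono fun a => g a b c d) (h₃ : ∀ a b d, StrictMono fun c => g a b c d)
    (h₄ : ∀ a b c, StrictMono fun d => g a b c d) {r : ℝ} (hr : 0 < r)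
    {σ a₁ b₁ t₁ a₂ b₂ t₂ a₃ b₃ t₃ : ℝ} (hσ : 0 < σ) (hσ' : σ < r)
    (hb₁ : |b₁| < r) (hb₂ : |b₂| < r) (hb₃ : |b₃| < r)
    (ha₁ : 0 < a₁) (ha₁' : a₁ < r) (ha₂ : 0 < a₂) (ha₂' : a₂ < r) (ha₃ : 0 < a₃) (ha₃' : a₃ < r)
    (ht₁ : -r < t₁) (ht₃ : -r < t₃)
    (h10 : g a₁ b₁ 0 0 = 0) (h20 : g a₂ b₂ 0 0 = 0) (h30 : g a₃ b₃ 0 0 = 0)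
    (h1t : g a₁ b₁ σ t₁ = 0) (h2t : g a₂ b₂ σ t₂ = 0) (h3t : g a₃ b₃ σ t₃ = 0)
    (h12 : t₁ < t₂) (h32 : t₃ < t₂) (hne : a₁ ≠ a₃) :
    HasSmallLoop (fun A B => g A.1 A.2 B.1 B.2 = 0) r := by
  have n1 : g a₂ b₂ σ t₁ < 0 := by rw [← h2t]; exact h₄ _ _ _ h12
  have n3 : g a₂ b₂ σ t₃ < 0 := by rw [← h2t]; exact h₄ _ _ _ h32
  have hcont : ∀ t, Continuous fun a => g a b₂ σ t := fun t =>
    hc.comp (f := fun a : ℝ => (a, b₂, σ, t)) (by fun_prop)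
  obtain ⟨a, ⟨⟨m1, m3⟩, m4⟩, m5⟩ := ((((((hcont t₁).continuousAt (x := a₂)).eventually_lt_const n1).and
    (((hcont t₃).continuousAt (x := a₂)).eventually_lt_const n3)).filter_mono
      nhdsWithin_le_nhds).and (Ioo_mem_nhdsGT ha₂') :
      ∀ᶠ a in nhdsWithin a₂ (Ioi a₂), (g a b₂ σ t₁ < 0 ∧ g a b₂ σ t₃ < 0) ∧ a ∈ Ioo a₂ r).exists.imp
      (fun a h => (⟨⟨h.1, h.2.1⟩, h.2.2⟩ :
        ((g a b₂ σ t₁ < 0 ∧ g a b₂ σ t₃ < 0) ∧ a₂ < a) ∧ a < r))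
  have hpos : 0 < g a b₂ 0 0 := h20.symm.trans_lt (h₁ _ _ _ m4)
  have key : ∀ a' b' t, -r < t → g a' b' 0 0 = 0 → g a' b' σ t = 0 → g a b₂ σ t < 0 →
      ∃ B : ℝ × ℝ, ‖B‖ < r ∧ B ≠ 0 ∧ g a' b' B.1 B.2 = 0 ∧ g a b₂ B.1 B.2 = 0 := by
    intro a' b' t ht e0 et hneg
    have hlo : ∀ c ∈ Icc 0 σ, g a' b' c (-r) < 0 := fun c hc => by
      rw [← et]; exact ((h₃ a' b' (-r)).monotone hc.2).trans_lt (h₄ _ _ _ ht)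
    have hhi : ∀ c ∈ Icc 0 σ, 0 < g a' b' c r := fun c hc => by
      rw [← e0]; exact (h₄ _ _ _ hr).trans_le ((h₃ a' b' r).monotone hc.1)
    obtain ⟨c, hc', d, hd, hf, hk⟩ := exists_common_zero (f := fun c d => g a' b' c d)
      (k := fun c d => g a b₂ c d) (α := 0) (β := σ) (lo := -r) (hi := r)
      (hc.comp (f := fun p : ℝ × ℝ => (a', b', p)) (by fun_prop))
      (hc.comp (f := fun p : ℝ × ℝ => (a, b₂, p)) (by fun_prop)) hσ.le (by linarith)
      (fun c _ => (h₄ a' b' c).injective.injOn) (fun c hc => (hlo c hc).le)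
      (fun c hc => (hhi c hc).le)
      (fun d _ hd => by
        rw [(h₄ a' b' 0).injective (hd.trans e0.symm)]; exact hpos.le)
      (fun d _ hd => by
        rw [(h₄ a' b' σ).injective (hd.trans et.symm)]; exact hneg.le)
    refine ⟨(c, d), norm_mk_lt (abs_lt.2 ⟨by linarith [hc'.1], by linarith [hc'.2]⟩)
      (abs_lt.2 ⟨?_, ?_⟩), ?_, hf, hk⟩
    · refine lt_of_le_of_ne hd.1 ?_
      rintro rfl
      exact (hlo c hc').ne hf
    · refine lt_of_le_of_ne hd.2 ?_
      rintro rfl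
      exact (hhi c hc').ne' hf
    · intro h
      obtain ⟨rfl, rfl⟩ := Prod.mk.inj h
      exact hpos.ne' hk
  obtain ⟨B₁, k1, k2, k3, k4⟩ := key a₁ b₁ t₁ ht₁ h10 h1t m1
  obtain ⟨B₂, l1, l2, l3, l4⟩ := key a₃ b₃ t₃ ht₃ h30 h3t m3
  have q1 : ‖(a₁, b₁)‖ < r := norm_mk_lt (by rwa [abs_of_pos ha₁]) hb₁
  have q2 : ‖(a, b₂)‖ < r := norm_mk_lt (by rwa [abs_of_pos (ha₂.trans m4)]) hb₂
  have q3 : ‖(a₃, b₃)‖ < r := norm_mk_lt (by rwa [abs_of_pos ha₃]) hb₃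
  have z1 : (a₁, b₁) ≠ 0 := fun h => ha₁.ne' (Prod.mk.inj h).1
  have z3 : (a₃, b₃) ≠ 0 := fun h => ha₃.ne' (Prod.mk.inj h).1
  by_cases hB : B₁ = B₂
  · subst hB
    exact Or.inl ⟨(a₁, b₁), (a₃, b₃), B₁, q1, q3, k1, z1, z3, fun h => hne (Prod.mk.inj h).1, k2,
      h10, h30, k3, l3⟩
  · refine Or.inr ⟨(a₁, b₁), (a, b₂), (a₃, b₃), B₁, B₂, q1, q2, q3, k1, l1, z1, z3, ?_, ?_, k2, l2,
      hB, h10, h30, k3, k4, l4, l3⟩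
    · intro h
      obtain ⟨rfl, rfl⟩ := Prod.mk.inj h
      exact hpos.ne' h10
    · intro h
      obtain ⟨rfl, rfl⟩ := Prod.mk.inj h
      exact hpos.ne' h30

theorem hasSmallLoop {g : ℝ → ℝ → ℝ → ℝ → ℝ}
    (hc : Continuous fun p : ℝ × ℝ × ℝ × ℝ => g p.1 p.2.1 p.2.2.1 p.2.2.2)
    (h₁ : ∀ b c d, StrictMono fun a => g a b c d) (h₂ : ∀ a c d, StrictMono fun b => g a b c d)
    (h₃ : ∀ a b d, StrictMono fun c => g a b c d) (h₄ : ∀ a b c, StrictMono fun d => g a b c d)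
    (h0 : g 0 0 0 0 = 0) {r : ℝ} (hr : 0 < r) :
    HasSmallLoop (fun A B => g A.1 A.2 B.1 B.2 = 0) r := by
  obtain ⟨s, hs, hsr, hsol⟩ := exists_zero_of_strictMono (h := fun a b => g a b 0 0)
    (hc.comp (f := fun p : ℝ × ℝ => (p.1, p.2, 0, 0)) (by fun_prop)) (fun t => h₁ t 0 0)
    (fun s => h₂ s 0 0) h0 hr
  obtain ⟨b₁, hb₁, hb₁', e₁⟩ := hsol (s / 3) (by linarith) (by linarith)
  obtain ⟨b₂, hb₂, hb₂', e₂⟩ := hsol (s / 2) (by linarith) (by linarith)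
  obtain ⟨b₃, hb₃, hb₃', e₃⟩ := hsol s (by linarith) (by linarith)
  have hsol' : ∀ a b, g a b 0 0 = 0 → ∃ s₀, 0 < s₀ ∧ s₀ < r ∧ ∀ s, 0 < s → s ≤ s₀ →
      ∃ t, -r < t ∧ t < 0 ∧ g a b s t = 0 := fun a b hab =>
    exists_zero_of_strictMono (h := fun c d => g a b c d)
      (hc.comp (f := fun p : ℝ × ℝ => (a, b, p)) (by fun_prop)) (fun t => h₃ a b t)
      (fun s => h₄ a b s) hab hr
  obtain ⟨σ₁, p₁, p₁', hσ₁⟩ := hsol' _ _ e₁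
  obtain ⟨σ₂, p₂, p₂', hσ₂⟩ := hsol' _ _ e₂
  obtain ⟨σ₃, p₃, p₃', hσ₃⟩ := hsol' _ _ e₃
  obtain ⟨σ, hσ, l₁, l₂, l₃⟩ : ∃ σ, 0 < σ ∧ σ ≤ σ₁ ∧ σ ≤ σ₂ ∧ σ ≤ σ₃ :=
    ⟨min σ₁ (min σ₂ σ₃), lt_min p₁ (lt_min p₂ p₃), min_le_left _ _,
      (min_le_right _ _).trans (min_le_left _ _), (min_le_right _ _).trans (min_le_right _ _)⟩
  obtain ⟨t₁, ht₁, ht₁', f₁⟩ := hσ₁ σ hσ l₁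
  obtain ⟨t₂, ht₂, ht₂', f₂⟩ := hσ₂ σ hσ l₂
  obtain ⟨t₃, ht₃, ht₃', f₃⟩ := hσ₃ σ hσ l₃
  have hσr : σ < r := l₁.trans_lt p₁'
  have hb₁r : |b₁| < r := abs_lt.2 ⟨hb₁, hb₁'.trans hr⟩
  have hb₂r : |b₂| < r := abs_lt.2 ⟨hb₂, hb₂'.trans hr⟩
  have hb₃r : |b₃| < r := abs_lt.2 ⟨hb₃, hb₃'.trans hr⟩
  have quad : ∀ a b a' b' t, 0 < a → 0 < a' → a < r → a' < r → |b| < r → |b'| < r → a ≠ a' →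
      -r < t → t < 0 → g a b 0 0 = 0 → g a' b' 0 0 = 0 → g a b σ t = 0 → g a' b' σ t = 0 →
      HasSmallLoop (fun A B => g A.1 A.2 B.1 B.2 = 0) r := by
    intro a b a' b' t ha ha' har har' hbr hbr' hne ht ht' x1 x2 x3 x4
    exact Or.inl ⟨(a, b), (a', b'), (σ, t), norm_mk_lt (by rwa [abs_of_pos ha]) hbr,
      norm_mk_lt (by rwa [abs_of_pos ha']) hbr',
      norm_mk_lt (by rwa [abs_of_pos hσ]) (abs_lt.2 ⟨ht, ht'.trans hr⟩),
      fun h => ha.ne' (Prod.mk.inj h).1, fun h => ha'.ne' (Prod.mk.inj h).1,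
      fun h => hne (Prod.mk.inj h).1, fun h => hσ.ne' (Prod.mk.inj h).1, x1, x2, x3, x4⟩
  have s1 : 0 < s / 3 := by linarith
  have s2 : 0 < s / 2 := by linarith
  have s1' : s / 3 < r := by linarith
  have s2' : s / 2 < r := by linarith
  have d12 : s / 3 ≠ s / 2 := by intro h; linarith
  have d13 : s / 3 ≠ s := by intro h; linarith
  have d23 : s / 2 ≠ s := by intro h; linarith
  by_cases h12 : t₁ = t₂
  · subst h12
    exact quad _ _ _ _ _ s1 s2 s1' s2' hb₁r hb₂r d12 ht₁ ht₁' e₁ e₂ f₁ f₂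
  by_cases h13 : t₁ = t₃
  · subst h13
    exact quad _ _ _ _ _ s1 hs s1' hsr hb₁r hb₃r d13 ht₁ ht₁' e₁ e₃ f₁ f₃
  by_cases h23 : t₂ = t₃
  · subst h23
    exact quad _ _ _ _ _ s2 hs s2' hsr hb₂r hb₃r d23 ht₂ ht₂' e₂ e₃ f₂ f₃
  rcases lt_or_gt_of_ne h12 with h12 | h12
  · rcases lt_or_gt_of_ne h23 with h23 | h23
    · exact hasSmallLoop_of_lt hc h₁ h₃ h₄ hr hσ hσr hb₁r hb₃r hb₂r s1 s1' hs hsr s2 s2' ht₁ ht₂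
        e₁ e₃ e₂ f₁ f₃ f₂ (h12.trans h23) h23 d12
    · exact hasSmallLoop_of_lt hc h₁ h₃ h₄ hr hσ hσr hb₁r hb₂r hb₃r s1 s1' s2 s2' hs hsr ht₁ ht₃
        e₁ e₂ e₃ f₁ f₂ f₃ h12 h23 d13
  · rcases lt_or_gt_of_ne h13 with h13 | h13
    · exact hasSmallLoop_of_lt hc h₁ h₃ h₄ hr hσ hσr hb₁r hb₃r hb₂r s1 s1' hs hsr s2 s2' ht₁ ht₂
        e₁ e₃ e₂ f₁ f₃ f₂ h13 (h12.trans h13) d12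
    · exact hasSmallLoop_of_lt hc h₁ h₃ h₄ hr hσ hσr hb₂r hb₁r hb₃r s2 s2' s1 s1' hs hsr ht₂ ht₃
        e₂ e₁ e₃ f₂ f₁ f₃ h12 h13 d23

end Analysis

section Connectedness

variable {X : Type*} [CircularOrder X] [TopologicalSpace X] {M : MonotoneMobius X}

namespace MobiusChart

variable {ω : X} (c : MobiusChart M ω)

theorem e_ne {s t : ℝ} (h : s ≠ t) : c.e s ≠ c.e t := c.inj.ne h

theorem dist_pos {s t : ℝ} (h : s ≠ t) : 0 < M.D ω (c.e s) (c.e t) :=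
  M.pos ω _ _ (c.e_ne h) (c.ne s) (c.ne t)

theorem dist_nonneg (s t : ℝ) : 0 ≤ M.D ω (c.e s) (c.e t) := by
  rcases eq_or_ne s t with rfl | h
  · rw [M.refl]
  · exact (c.dist_pos h).le

theorem continuous_dist {T : Type*} [TopologicalSpace T] {f g : T → ℝ} (hf : Continuous f)
    (hg : Continuous g) : Continuous fun t => M.D ω (c.e (f t)) (c.e (g t)) :=
  c.cont.comp (hf.prodMk hg)

end MobiusChart

theorem MonotoneMobius.exists_harmonic (M : MonotoneMobius X) {x y z : X} (hxy : x ≠ y)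
    (hxz : x ≠ z) (hyz : y ≠ z) : ∃ u, u ≠ x ∧ u ≠ y ∧ u ≠ z ∧ M.Harmonic x y z u := by
  obtain ⟨c⟩ := M.nonempty_chart z
  obtain ⟨p, rfl⟩ := c.surj x hxz
  obtain ⟨q, rfl⟩ := c.surj y hyz
  have hpq : p ≠ q := fun h => hxy (h ▸ rfl)
  have hcont : Continuous fun s => M.D z (c.e s) (c.e p) - M.D z (c.e s) (c.e q) :=
    (c.continuous_dist continuous_id continuous_const).sub
      (c.continuous_dist continuous_id continuous_const)
  obtain ⟨s, -, hs⟩ := intermediate_value_uIcc (a := p) (b := q) hcont.continuousOn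
    (show (0 : ℝ) ∈ _ by
      have h1 := c.dist_pos hpq
      have h2 := c.dist_pos hpq.symm
      rw [Set.mem_uIcc]
      left
      simp only [M.refl]
      constructor <;> linarith)
  have hs : M.D z (c.e s) (c.e p) - M.D z (c.e s) (c.e q) = 0 := hs
  have h1 : s ≠ p := by
    rintro rfl
    rw [M.refl] at hs
    linarith [c.dist_pos hpq]
  have h2 : s ≠ q := by
    rintro rfl
    rw [M.refl] at hs
    linarith [c.dist_pos hpq.symm]
  refine ⟨c.e s, c.e_ne h1, c.e_ne h2, c.ne s, ?_⟩
  exact Harmonic.swap_pairs M ((M.harmonic_iff_remote_mem (c.ne s).symm hxz.symm hyz.symm).2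
    (by linarith))

namespace MobiusChart

variable {ω : X} (c : MobiusChart M ω)

theorem exists_reflection {a s : ℝ} (h : a < s) :
    ∃ t < a, M.D ω (c.e a) (c.e t) = M.D ω (c.e a) (c.e s) := by
  obtain ⟨u, h1, h2, h3, hu⟩ := M.exists_harmonic (c.ne a).symm (c.ne s).symm (c.e_ne h.ne)
  obtain ⟨t, rfl⟩ := c.surj u h1
  have ht := (M.harmonic_iff_remote_mem (c.ne a).symm (c.ne s).symm h1.symm).1 hu
  refine ⟨t, ?_, ht.symm⟩
  by_contra! hta
  have h2' : t ≠ a := fun h => h2 (h ▸ rfl)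
  have h3' : t ≠ s := fun h => h3 (h ▸ rfl)
  rcases lt_or_gt_of_ne h3' with h' | h'
  · exact (c.lt_outer (lt_of_le_of_ne hta h2'.symm) h').1.ne' ht
  · exact (c.lt_outer h h').1.ne ht

theorem exists_common_perp_remote {a c₁ c₂ : ℝ} (h1 : a < c₁) (h2 : c₁ < c₂) :
    ∃ t s, t < a ∧ c₁ < s ∧ s < c₂ ∧ M.Harmonic ω (c.e a) (c.e t) (c.e s) ∧
      M.Harmonic (c.e c₁) (c.e c₂) (c.e t) (c.e s) := by
  obtain ⟨t₀, ht₀, hD⟩ := c.exists_reflection (h1.trans h2)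
  have hzero := exists_common_zero
    (f := fun s w => M.D ω (c.e a) (c.e (a - w)) - M.D ω (c.e a) (c.e s))
    (k := fun s w => M.D ω (c.e c₁) (c.e (a - w)) * M.D ω (c.e c₂) (c.e s) -
      M.D ω (c.e c₁) (c.e s) * M.D ω (c.e c₂) (c.e (a - w)))
    (α := c₁) (β := c₂) (lo := 0) (hi := a - t₀)
    (.sub (c.continuous_dist (by fun_prop) (by fun_prop))
      (c.continuous_dist (by fun_prop) (by fun_prop)))
    (.sub (.mul (c.continuous_dist (by fun_prop) (by fun_prop))
      (c.continuous_dist (by fun_prop) (by fun_prop)))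
      (.mul (c.continuous_dist (by fun_prop) (by fun_prop))
      (c.continuous_dist (by fun_prop) (by fun_prop)))) h2.le (by linarith) ?_ ?_ ?_ ?_ ?_
  · obtain ⟨s, hs, w, hw, hf, hk⟩ := hzero
    have hs1 : s ≠ c₁ := by
      rintro rfl
      rw [M.refl] at hk
      have := mul_pos (c.dist_pos (s := s) (t := a - w) (by intro h; linarith [hw.1]))
        (c.dist_pos h2.ne')
      linarith
    have hs2 : s ≠ c₂ := by
      rintro rfl
      rw [M.refl] at hk
      have := mul_pos (c.dist_pos h2.ne)
        (c.dist_pos (s := s) (t := a - w) (by intro h; linarith [hw.1]))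
      linarith
    have hw0 : w ≠ 0 := by
      rintro rfl
      rw [sub_zero, M.refl] at hf
      have := c.dist_pos (s := a) (t := s) (by intro h; linarith [hs.1])
      linarith
    have hw1 : 0 < w := lt_of_le_of_ne hw.1 hw0.symm
    refine ⟨a - w, s, by linarith, lt_of_le_of_ne hs.1 hs1.symm, lt_of_le_of_ne hs.2 hs2, ?_, ?_⟩
    · exact (M.harmonic_iff_remote_mem (c.ne _).symm (c.ne _).symm (c.ne _).symm).2 (by linarith)
    · exact M.harmonic_of_remote (c.ne _) (c.ne _) (c.ne _) (c.ne _) (by linarith)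
  · intro s hs
    have hanti : StrictMonoOn (fun w => M.D ω (c.e a) (c.e (a - w)) - M.D ω (c.e a) (c.e s))
        (Set.Icc 0 (a - t₀)) := by
      intro w hw w' hw' hlt
      refine sub_lt_sub_right ?_ _
      rw [M.symm ω (c.e a), M.symm ω (c.e a)]
      rcases hw.1.eq_or_lt with rfl | h
      · rw [sub_zero, M.refl]
        exact c.dist_pos (by intro h; linarith)
      · exact (c.lt_outer (s := a - w') (t := a - w) (r := a) (by linarith) (by linarith)).2
    exact hanti.injOn
  · intro s hs
    rw [sub_zero, M.refl]
    linarith [c.dist_nonneg a s]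
  · intro s hs
    rw [sub_sub_cancel, hD]
    rcases hs.2.eq_or_lt with rfl | h
    · simp
    · linarith [(c.lt_outer (h1.trans_le hs.1) h).1]
  · intro w _ _
    rw [M.refl]
    linarith [mul_nonneg (c.dist_nonneg c₁ (a - w)) (c.dist_nonneg c₂ c₁)]
  · intro w _ _
    rw [M.refl]
    linarith [mul_nonneg (c.dist_nonneg c₁ c₂) (c.dist_nonneg c₂ (a - w))]

end MobiusChart

theorem HarmPt.exists_common_perp {a₁ a₂ c₁ c₂ : X} (h12 : a₁ ≠ a₂) (h11 : a₁ ≠ c₁)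
    (h12' : a₁ ≠ c₂) (h21 : a₂ ≠ c₁) (h22 : a₂ ≠ c₂) (hc : c₁ ≠ c₂)
    (h : M.D a₁ c₁ c₂ < M.D a₁ a₂ c₂) :
    ∃ q₁ q₂ : HarmPt M, q₁.x = a₁ ∧ q₁.y = a₂ ∧ q₂.x = c₁ ∧ q₂.y = c₂ ∧
      q₁.z = q₂.z ∧ q₁.u = q₂.u := by
  suffices hp : ∃ p p', a₁ ≠ p ∧ a₁ ≠ p' ∧ a₂ ≠ p ∧ a₂ ≠ p' ∧ c₁ ≠ p ∧ c₁ ≠ p' ∧ c₂ ≠ p ∧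
      c₂ ≠ p' ∧ p ≠ p' ∧ M.Harmonic a₁ a₂ p p' ∧ M.Harmonic c₁ c₂ p p' by
    obtain ⟨p, p', k1, k2, k3, k4, k5, k6, k7, k8, k9, k10, k11⟩ := hp
    exact ⟨⟨a₁, a₂, p, p', h12, k1, k2, k3, k4, k9, k10⟩, ⟨c₁, c₂, p, p', hc, k5, k6, k7, k8, k9, k11⟩,
      rfl, rfl, rfl, rfl, rfl, rfl⟩
  have main : ∀ (c : MobiusChart M a₁) (a γ₁ γ₂ : ℝ), a < γ₁ → γ₁ < γ₂ →
      ∃ p p', a₁ ≠ p ∧ a₁ ≠ p' ∧ c.e a ≠ p ∧ c.e a ≠ p' ∧ c.e γ₁ ≠ p ∧ c.e γ₁ ≠ p' ∧ c.e γ₂ ≠ p ∧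
      c.e γ₂ ≠ p' ∧ p ≠ p' ∧ M.Harmonic a₁ (c.e a) p p' ∧ M.Harmonic (c.e γ₁) (c.e γ₂) p p' := by
    intro c a γ₁ γ₂ l1 l2
    obtain ⟨t, s, m1, m2, m3, m4, m5⟩ := c.exists_common_perp_remote l1 l2
    refine ⟨c.e t, c.e s, (c.ne t).symm, (c.ne s).symm, c.e_ne ?_, c.e_ne ?_, c.e_ne ?_, c.e_ne ?_,
      c.e_ne ?_, c.e_ne ?_, c.e_ne ?_, m4, m5⟩
    all_goals intro h; linarith
  have main' : ∀ (c : MobiusChart M a₁) (a γ₁ γ₂ : ℝ), a < γ₁ → a < γ₂ → γ₁ ≠ γ₂ →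
      ∃ p p', a₁ ≠ p ∧ a₁ ≠ p' ∧ c.e a ≠ p ∧ c.e a ≠ p' ∧ c.e γ₁ ≠ p ∧ c.e γ₁ ≠ p' ∧ c.e γ₂ ≠ p ∧
      c.e γ₂ ≠ p' ∧ p ≠ p' ∧ M.Harmonic a₁ (c.e a) p p' ∧ M.Harmonic (c.e γ₁) (c.e γ₂) p p' := by
    intro c a γ₁ γ₂ l1 l2 l3
    rcases lt_or_gt_of_ne l3 with l3 | l3
    · exact main c a γ₁ γ₂ l1 l3
    · obtain ⟨p, p', k1, k2, k3, k4, k5, k6, k7, k8, k9, k10, k11⟩ := main c a γ₂ γ₁ l2 l3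
      exact ⟨p, p', k1, k2, k3, k4, k7, k8, k5, k6, k9, k10, MonotoneMobius.Harmonic.swap_left M k11⟩
  obtain ⟨c⟩ := M.nonempty_chart a₁
  obtain ⟨a, rfl⟩ := c.surj a₂ h12.symm
  obtain ⟨γ₁, rfl⟩ := c.surj c₁ h11.symm
  obtain ⟨γ₂, rfl⟩ := c.surj c₂ h12'.symm
  have ha1 : a ≠ γ₁ := fun h => h21 (h ▸ rfl)
  have ha2 : a ≠ γ₂ := fun h => h22 (h ▸ rfl)
  have h12 : γ₁ ≠ γ₂ := fun h => hc (h ▸ rfl)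
  rcases lt_or_gt_of_ne ha1 with l1 | l1 <;> rcases lt_or_gt_of_ne ha2 with l2 | l2
  · exact main' c a γ₁ γ₂ l1 l2 h12
  · have := (c.lt_outer l2 l1).1
    rw [M.symm _ _ (c.e a), M.symm _ _ (c.e γ₁)] at this
    exact absurd h this.not_gt
  · exact absurd h (c.lt_outer l1 l2).2.not_gt
  · have := main' c.neg (-a) (-γ₁) (-γ₂) (by linarith) (by linarith) (by simpa using h12)
    simpa only [MobiusChart.neg, neg_neg] using this

theorem HarmPt.exists_joining_of_chart {ω : X} (c : MobiusChart M ω) {c₁ c₂ : ℝ} (hc : c₁ < c₂)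
    (q : HarmPt M) {a₁ a₂ : ℝ} (h1 : c.e a₁ = q.x) (h2 : c.e a₂ = q.y) (l1 : a₁ < c₁)
    (l2 : a₂ < c₁) : ∃ q₁ q₂ : HarmPt M, leftAxisEq q q₁ ∧ rightAxisEq q₁ q₂ ∧
      q₂.x = c.e c₁ ∧ q₂.y = c.e c₂ := by
  have main : ∀ b₁ b₂, b₁ < b₂ → b₂ < c₁ → ∃ q₁ q₂ : HarmPt M, q₁.x = c.e b₁ ∧ q₁.y = c.e b₂ ∧
      q₂.x = c.e c₁ ∧ q₂.y = c.e c₂ ∧ q₁.z = q₂.z ∧ q₁.u = q₂.u := by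
    intro b₁ b₂ k1 k2
    refine HarmPt.exists_common_perp (c.e_ne k1.ne) (c.e_ne (k1.trans k2).ne)
      (c.e_ne (k1.trans (k2.trans hc)).ne) (c.e_ne k2.ne) (c.e_ne (k2.trans hc).ne) (c.e_ne hc.ne)
      ?_
    obtain ⟨κ, hκ, hD⟩ := M.inversion ω (c.e b₁) (c.ne b₁).symm
    have p1 := c.dist_pos (k1.trans k2).ne'
    have p2 := c.dist_pos (k1.trans (k2.trans hc)).ne'
    have p3 := c.dist_pos k1.ne'
    rw [hD _ _ (c.ne _) (c.ne _) (c.e_ne (k1.trans k2).ne') (c.e_ne (k1.trans (k2.trans hc)).ne'),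
      hD _ _ (c.ne _) (c.ne _) (c.e_ne k1.ne') (c.e_ne (k1.trans (k2.trans hc)).ne'),
      div_lt_div_iff₀ (by positivity) (by positivity)]
    have := (c.lt_cross k1 k2 hc).1
    rw [M.symm ω (c.e b₁), M.symm ω (c.e b₁)] at this
    have := mul_lt_mul_of_pos_left this (mul_pos hκ p2)
    linarith
  have hne : a₁ ≠ a₂ := fun h => q.hxy (by rw [← h1, ← h2, h])
  rcases lt_or_gt_of_ne hne with h | h
  · obtain ⟨q₁, q₂, e1, e2, e3, e4, e5, e6⟩ := main a₁ a₂ h l2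
    exact ⟨q₁, q₂, Or.inl ⟨by rw [e1, h1], by rw [e2, h2]⟩, Or.inl ⟨e5, e6⟩, e3, e4⟩
  · obtain ⟨q₁, q₂, e1, e2, e3, e4, e5, e6⟩ := main a₂ a₁ h l1
    exact ⟨q₁, q₂, Or.inr ⟨by rw [e2, h1], by rw [e1, h2]⟩, Or.inl ⟨e5, e6⟩, e3, e4⟩

theorem HarmPt.exists_joinedWithin (q q' : HarmPt M) : ∃ r, JoinedWithin q q' r := by
  obtain ⟨ω, h1, h2, h3, h4⟩ := M.exists_ne_of_four q.x q.y q'.x q'.y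
  obtain ⟨c⟩ := M.nonempty_chart ω
  obtain ⟨a₁, ha₁⟩ := c.surj _ h1.symm
  obtain ⟨a₂, ha₂⟩ := c.surj _ h2.symm
  obtain ⟨b₁, hb₁⟩ := c.surj _ h3.symm
  obtain ⟨b₂, hb₂⟩ := c.surj _ h4.symm
  obtain ⟨γ, hγ⟩ := exists_gt (max (max a₁ a₂) (max b₁ b₂))
  simp only [max_lt_iff] at hγ
  obtain ⟨q₁, q₂, k1, k2, k3, k4⟩ := q.exists_joining_of_chart c (lt_add_one γ) ha₁ ha₂
    hγ.1.1 hγ.1.2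
  obtain ⟨q₁', q₂', l1, l2, l3, l4⟩ := q'.exists_joining_of_chart c (lt_add_one γ) hb₁ hb₂
    hγ.2.1 hγ.2.2
  have hax : leftAxisEq q₂ q₂' := Or.inl ⟨k3.trans l3.symm, k4.trans l4.symm⟩
  exact ⟨_, (((((JoinedWithin.refl q').cons_left l1.symm).cons_right l2.symm).cons_left
    hax).cons_right k2).cons_left k1⟩

end Connectedness

section Loops

variable {X : Type*} [CircularOrder X] [TopologicalSpace X] {M : MonotoneMobius X}

theorem exists_zz_of_hasSmallLoop {O : ℝ × ℝ → ℝ × ℝ → Prop} {r η : ℝ} (hη : 0 ≤ η)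
    {P : HarmPt M → ℝ × ℝ → ℝ × ℝ → Prop}
    (hP : ∀ A B, ‖A‖ < r → ‖B‖ < r → O A B → ∃ q, P q A B)
    (hl : ∀ {q q' A B B'}, P q A B → P q' A B' →
      leftAxisEq q q' ∧ stepDistL q q' ≤ η ∧ (B ≠ B' → ¬ rightAxisEq q q'))
    (hr : ∀ {q q' A A' B}, P q A B → P q' A' B →
      rightAxisEq q q' ∧ stepDistR q q' ≤ η ∧ (A ≠ A' → ¬ leftAxisEq q q'))
    (h : HasSmallLoop O r) {q₀ : HarmPt M} (h₀ : P q₀ 0 0) :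
    ∃ b n s, s ≤ 7 * η ∧ ZZ q₀ q₀ b (n + 1) s := by
  rcases h with ⟨A₁, A₂, B, a1, a2, b1, n1, n2, n12, nB, o1, o2, o3, o4⟩ |
    ⟨A₁, A₂, A₃, B₁, B₂, a1, a2, a3, b1, b2, n1, n3, n12, n23, m1, m2, m12, o1, o2, o3, o4, o5, o6⟩
  · have hr0 : ‖(0 : ℝ × ℝ)‖ < r := by rw [norm_zero]; exact (norm_nonneg _).trans_lt a1
    obtain ⟨q₁, h₁⟩ := hP _ _ a1 hr0 o1
    obtain ⟨q₂, h₂⟩ := hP _ _ a1 b1 o3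
    obtain ⟨q₃, h₃⟩ := hP _ _ a2 b1 o4
    obtain ⟨q₄, h₄⟩ := hP _ _ a2 hr0 o2
    obtain ⟨x1, y1, z1⟩ := hr h₀ h₁
    obtain ⟨x2, y2, z2⟩ := hl h₁ h₂
    obtain ⟨x3, y3, z3⟩ := hr h₂ h₃
    obtain ⟨x4, y4, z4⟩ := hl h₃ h₄
    obtain ⟨x5, y5, z5⟩ := hr h₄ h₀
    exact ⟨_, _, _, by linarith, ZZ.right (z1 n1.symm) x1 (ZZ.left (z2 nB.symm) x2
      (ZZ.right (z3 n12) x3 (ZZ.left (z4 nB) x4 (ZZ.right (z5 n2) x5 (ZZ.nil _ _)))))⟩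
  · have hr0 : ‖(0 : ℝ × ℝ)‖ < r := by rw [norm_zero]; exact (norm_nonneg _).trans_lt a1
    obtain ⟨q₁, h₁⟩ := hP _ _ a1 hr0 o1
    obtain ⟨q₂, h₂⟩ := hP _ _ a1 b1 o3
    obtain ⟨q₃, h₃⟩ := hP _ _ a2 b1 o4
    obtain ⟨q₄, h₄⟩ := hP _ _ a2 b2 o5
    obtain ⟨q₅, h₅⟩ := hP _ _ a3 b2 o6
    obtain ⟨q₆, h₆⟩ := hP _ _ a3 hr0 o2
    obtain ⟨x1, y1, z1⟩ := hr h₀ h₁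
    obtain ⟨x2, y2, z2⟩ := hl h₁ h₂
    obtain ⟨x3, y3, z3⟩ := hr h₂ h₃
    obtain ⟨x4, y4, z4⟩ := hl h₃ h₄
    obtain ⟨x5, y5, z5⟩ := hr h₄ h₅
    obtain ⟨x6, y6, z6⟩ := hl h₅ h₆
    obtain ⟨x7, y7, z7⟩ := hr h₆ h₀
    exact ⟨_, _, _, by linarith, ZZ.right (z1 n1.symm) x1 (ZZ.left (z2 m1.symm) x2
      (ZZ.right (z3 n12) x3 (ZZ.left (z4 m12) x4 (ZZ.right (z5 n23) x5 (ZZ.left (z6 m2) x6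
      (ZZ.right (z7 n3) x7 (ZZ.nil _ _)))))))⟩

/-- The projection of the real line onto `[-r, r]`. -/
def clamp (r a : ℝ) : ℝ := max (-r) (min a r)

theorem continuous_clamp (r : ℝ) : Continuous (clamp r) := by unfold clamp; fun_prop

theorem clamp_mem {r : ℝ} (hr : 0 < r) (a : ℝ) : -r ≤ clamp r a ∧ clamp r a ≤ r :=
  ⟨le_max_left _ _, max_le (by linarith) (min_le_right _ _)⟩

theorem clamp_of_abs_lt {r a : ℝ} (h : |a| < r) : clamp r a = a := by
  rw [abs_lt] at h
  rw [clamp, min_eq_left h.2.le, max_eq_right h.1.le]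

theorem clamp_lt {r a a' : ℝ} (hr : 0 < r) (h : a < a') :
    (clamp r a < clamp r a' ∧ a - clamp r a ≤ a' - clamp r a') ∨
      (clamp r a = clamp r a' ∧ a - clamp r a < a' - clamp r a') := by
  unfold clamp
  grind

namespace MobiusChart

variable {ω : X} (c : MobiusChart M ω)

/-- The logarithm of the cross-ratio of the pairs `(x, y)` and `(s, t)` in a chart. -/
noncomputable def logCross (x y s t : ℝ) : ℝ :=
  Real.log (M.D ω (c.e x) (c.e s)) + Real.log (M.D ω (c.e y) (c.e t)) -
    (Real.log (M.D ω (c.e x) (c.e t)) + Real.log (M.D ω (c.e y) (c.e s)))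

theorem logCross_eq_zero_iff {x y s t : ℝ} (h1 : x < s) (h2 : s < y) (h3 : y < t) :
    c.logCross x y s t = 0 ↔ M.Harmonic (c.e x) (c.e y) (c.e s) (c.e t) := by
  have p1 := c.dist_pos h1.ne
  have p2 := c.dist_pos h3.ne
  have p3 := c.dist_pos (h1.trans (h2.trans h3)).ne
  have p4 := c.dist_pos h2.ne'
  rw [logCross, ← Real.log_mul p1.ne' p2.ne', ← Real.log_mul p3.ne' p4.ne', sub_eq_zero]
  constructor
  · intro h
    exact M.harmonic_of_remote (c.ne _) (c.ne _) (c.ne _) (c.ne _)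
      (Real.log_injOn_pos (mul_pos p1 p2) (mul_pos p3 p4) h)
  · intro h
    rw [h ω (c.ne _).symm (c.ne _).symm (c.ne _).symm (c.ne _).symm]

theorem log_add_log_lt {a b d f : ℝ} (ha : 0 < a) (hb : 0 < b) (hd : 0 < d) (hf : 0 < f)
    (h : a * b < d * f) : Real.log a + Real.log b < Real.log d + Real.log f := by
  rw [← Real.log_mul ha.ne' hb.ne', ← Real.log_mul hd.ne' hf.ne']
  exact Real.log_lt_log (mul_pos ha hb) h

theorem logCross_lt₁ {x x' y s t : ℝ} (hx : x < x') (h1 : x' < s) (h2 : s < y) (h3 : y < t) :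
    c.logCross x' y s t < c.logCross x y s t := by
  have := log_add_log_lt (c.dist_pos (by linarith : x < t).ne) (c.dist_pos h1.ne)
    (c.dist_pos (by linarith : x < s).ne) (c.dist_pos (by linarith : x' < t).ne)
    (c.lt_cross hx h1 (h2.trans h3)).2
  unfold logCross
  linarith

theorem logCross_lt₂ {x y y' s t : ℝ} (h2 : s < y) (hy : y < y') (h3 : y' < t) :
    c.logCross x y' s t < c.logCross x y s t := by
  have := log_add_log_lt (c.dist_pos h2.ne) (c.dist_pos h3.ne)
    (c.dist_pos (h2.trans hy).ne) (c.dist_pos (hy.trans h3).ne) (c.lt_cross h2 hy h3).1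
  unfold logCross
  rw [M.symm ω (c.e y) (c.e s), M.symm ω (c.e y') (c.e s)]
  linarith

theorem logCross_lt₃ {x y s s' t : ℝ} (h1 : x < s) (hs : s < s') (h2 : s' < y) :
    c.logCross x y s t < c.logCross x y s' t := by
  have := log_add_log_lt (c.dist_pos h1.ne) (c.dist_pos h2.ne)
    (c.dist_pos (h1.trans hs).ne) (c.dist_pos (hs.trans h2).ne) (c.lt_cross h1 hs h2).1
  unfold logCross
  rw [M.symm ω (c.e y) (c.e s), M.symm ω (c.e y) (c.e s')]
  linarith

theorem logCross_lt₄ {x y s t t' : ℝ} (h1 : x < s) (h2 : s < y) (h3 : y < t) (ht : t < t') :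
    c.logCross x y s t < c.logCross x y s t' := by
  have := log_add_log_lt (c.dist_pos (by linarith : x < t').ne) (c.dist_pos h3.ne)
    (c.dist_pos (by linarith : x < t).ne) (c.dist_pos (by linarith : y < t').ne)
    (c.lt_cross (h1.trans h2) h3 ht).2
  unfold logCross
  linarith

theorem hasSmallLoop_logCross {x y s t r : ℝ} (hr : 0 < r) (h1 : x + r < s - r)
    (h2 : s + r < y - r) (h3 : y + r < t - r) (h0 : c.logCross x y s t = 0) :
    HasSmallLoop (fun A B => c.logCross (x - A.1) (y - A.2) (s + B.1) (t + B.2) = 0) r := by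
  have hm := fun a => clamp_mem hr a
  have key := hasSmallLoop (r := r) (g := fun a b p q =>
    c.logCross (x - clamp r a) (y - clamp r b) (s + clamp r p) (t + clamp r q) +
      ((a - clamp r a) + (b - clamp r b) + (p - clamp r p) + (q - clamp r q)))
    ?_ ?_ ?_ ?_ ?_ ?_ hr
  · have hO : ∀ A B : ℝ × ℝ, ‖A‖ < r → ‖B‖ < r →
        (c.logCross (x - clamp r A.1) (y - clamp r A.2) (s + clamp r B.1) (t + clamp r B.2) +
        ((A.1 - clamp r A.1) + (A.2 - clamp r A.2) + (B.1 - clamp r B.1) +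
          (B.2 - clamp r B.2)) = 0) →
        c.logCross (x - A.1) (y - A.2) (s + B.1) (t + B.2) = 0 := by
      intro A B hA hB h
      rw [clamp_of_abs_lt ((norm_fst_le A).trans_lt hA), clamp_of_abs_lt ((norm_snd_le A).trans_lt hA),
        clamp_of_abs_lt ((norm_fst_le B).trans_lt hB),
        clamp_of_abs_lt ((norm_snd_le B).trans_lt hB)] at h
      linarith
    have z : ‖(0 : ℝ × ℝ)‖ < r := by rwa [norm_zero]
    rcases key with ⟨A₁, A₂, B, a1, a2, b1, n1, n2, n12, nB, o1, o2, o3, o4⟩ |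
      ⟨A₁, A₂, A₃, B₁, B₂, a1, a2, a3, b1, b2, n1, n3, n12, n23, m1, m2, m12, o1, o2, o3, o4, o5,
        o6⟩
    · exact Or.inl ⟨A₁, A₂, B, a1, a2, b1, n1, n2, n12, nB, hO _ _ a1 z o1, hO _ _ a2 z o2,
        hO _ _ a1 b1 o3, hO _ _ a2 b1 o4⟩
    · exact Or.inr ⟨A₁, A₂, A₃, B₁, B₂, a1, a2, a3, b1, b2, n1, n3, n12, n23, m1, m2, m12,
        hO _ _ a1 z o1, hO _ _ a3 z o2, hO _ _ a1 b1 o3, hO _ _ a2 b1 o4, hO _ _ a2 b2 o5,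
        hO _ _ a3 b2 o6⟩
  · have hc := continuous_clamp r
    have hlog : ∀ f g : ℝ × ℝ × ℝ × ℝ → ℝ, Continuous f → Continuous g → (∀ p, f p ≠ g p) →
        Continuous fun p => Real.log (M.D ω (c.e (f p)) (c.e (g p))) := fun f g hf hg hne =>
      (c.continuous_dist hf hg).log fun p => (c.dist_pos (hne p)).ne'
    refine Continuous.add (Continuous.sub (.add (hlog _ _ ?_ ?_ ?_) (hlog _ _ ?_ ?_ ?_))
      (.add (hlog _ _ ?_ ?_ ?_) (hlog _ _ ?_ ?_ ?_))) ?_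
    any_goals fun_prop
    · intro p h; linarith [hm p.1, hm p.2.2.1]
    · intro p h; linarith [hm p.2.1, hm p.2.2.2]
    · intro p h; linarith [hm p.1, hm p.2.2.2]
    · intro p h; linarith [hm p.2.1, hm p.2.2.1]
  · intro b p q a a' h
    rcases clamp_lt hr h with ⟨k1, k2⟩ | ⟨k1, k2⟩
    · have := c.logCross_lt₁ (x := x - clamp r a') (x' := x - clamp r a) (y := y - clamp r b)
        (s := s + clamp r p) (t := t + clamp r q) (by linarith) (by linarith [hm a, hm p])
        (by linarith [hm b, hm p]) (by linarith [hm b, hm q])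
      simp only
      linarith
    · simp only [k1]
      linarith
  · intro a p q b b' h
    rcases clamp_lt hr h with ⟨k1, k2⟩ | ⟨k1, k2⟩
    · have := c.logCross_lt₂ (x := x - clamp r a) (y := y - clamp r b') (y' := y - clamp r b)
        (s := s + clamp r p) (t := t + clamp r q)
        (by linarith [hm b', hm p]) (by linarith) (by linarith [hm b, hm q])
      simp only
      linarith
    · simp only [k1]
      linarith
  · intro a b q p p' h
    rcases clamp_lt hr h with ⟨k1, k2⟩ | ⟨k1, k2⟩
    · have := c.logCross_lt₃ (x := x - clamp r a) (y := y - clamp r b)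
        (s := s + clamp r p) (s' := s + clamp r p') (t := t + clamp r q)
        (by linarith [hm a, hm p]) (by linarith) (by linarith [hm b, hm p'])
      simp only
      linarith
    · simp only [k1]
      linarith
  · intro a b p q q' h
    rcases clamp_lt hr h with ⟨k1, k2⟩ | ⟨k1, k2⟩
    · have := c.logCross_lt₄ (x := x - clamp r a) (y := y - clamp r b)
        (s := s + clamp r p) (t := t + clamp r q) (t' := t + clamp r q')
        (by linarith [hm a, hm p]) (by linarith [hm b, hm p]) (by linarith [hm b, hm q])
        (by linarith)
      simp only
      linarith
    · simp only [k1]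
      linarith
  · have : clamp r 0 = 0 := clamp_of_abs_lt (by rwa [abs_zero])
    simp only [this, sub_zero, add_zero, h0]

theorem separated_of_harmonic {x y s t : ℝ} (hxy : x < y) (hst : s < t) (hxs : x ≠ s) (hxt : x ≠ t)
    (hys : y ≠ s) (hyt : y ≠ t) (h : M.Harmonic (c.e x) (c.e y) (c.e s) (c.e t)) :
    (x < s ∧ s < y ∧ y < t) ∨ (s < x ∧ x < t ∧ t < y) := by
  have h := h ω (c.ne _).symm (c.ne _).symm (c.ne _).symm (c.ne _).symm
  rcases lt_or_gt_of_ne hxs with l1 | l1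
  · rcases lt_or_gt_of_ne hys with l2 | l2
    · exact absurd h (c.lt_cross hxy l2 hst).2.ne'
    rcases lt_or_gt_of_ne hyt with l3 | l3
    · exact Or.inl ⟨l1, l2, l3⟩
    · have := (c.lt_cross l1 hst l3).1
      rw [M.symm ω (c.e t), M.symm ω (c.e s) (c.e y)] at this
      exact absurd h this.ne
  · rcases lt_or_gt_of_ne hxt with l2 | l2
    · rcases lt_or_gt_of_ne hyt with l3 | l3
      · have := (c.lt_cross l1 hxy l3).1
        rw [M.symm ω (c.e s), M.symm ω (c.e s), mul_comm (M.D ω (c.e y) (c.e s))] at this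
        exact absurd h this.ne
      · exact Or.inr ⟨l1, l2, l3⟩
    · have := (c.lt_cross hst l2 hxy).2
      rw [M.symm ω (c.e s), M.symm ω (c.e t) (c.e x), M.symm ω (c.e s), M.symm ω (c.e t) (c.e y),
        mul_comm] at this
      exact absurd h this.ne'

theorem exists_small_loop {x y s t : ℝ} (h1 : x < s) (h2 : s < y) (h3 : y < t) {q : HarmPt M}
    (hqx : q.x = c.e x) (hqy : q.y = c.e y) (hqz : q.z = c.e s) (hqu : q.u = c.e t) {ε : ℝ}
    (hε : 0 < ε) : ∃ b n l, l ≤ ε ∧ ZZ q q b (n + 1) l := by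
  let H : (ℝ × ℝ) × (ℝ × ℝ) → ℝ := fun p => Real.log (M.D ω (c.e (y - p.1.2)) (c.e (s + p.2.1))) -
    Real.log (M.D ω (c.e (x - p.1.1)) (c.e (s + p.2.1)))
  let K : (ℝ × ℝ) × (ℝ × ℝ) → ℝ := fun p => Real.log (M.D ω (c.e (t + p.2.2)) (c.e (x - p.1.1))) -
    Real.log (M.D ω (c.e (s + p.2.1)) (c.e (x - p.1.1)))
  have hlog : ∀ f g : (ℝ × ℝ) × (ℝ × ℝ) → ℝ, Continuous f → Continuous g → f 0 ≠ g 0 →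
      ContinuousAt (fun p => Real.log (M.D ω (c.e (f p)) (c.e (g p)))) 0 := fun f g hf hg hne =>
    (c.continuous_dist hf hg).continuousAt.log (c.dist_pos hne).ne'
  have hH : ContinuousAt H 0 := by
    refine (hlog _ _ ?_ ?_ ?_).sub (hlog _ _ ?_ ?_ ?_)
    any_goals fun_prop
    all_goals
      intro h
      simp only [Prod.fst_zero, Prod.snd_zero] at h
      linarith
  have hK : ContinuousAt K 0 := by
    refine (hlog _ _ ?_ ?_ ?_).sub (hlog _ _ ?_ ?_ ?_)
    any_goals fun_prop
    all_goals
      intro h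
      simp only [Prod.fst_zero, Prod.snd_zero] at h
      linarith
  obtain ⟨ρ, hρ, hball⟩ := Metric.eventually_nhds_iff.1
    ((Metric.tendsto_nhds.1 hH (ε / 14) (by positivity)).and
      (Metric.tendsto_nhds.1 hK (ε / 14) (by positivity)))
  obtain ⟨r, hr, hrρ, r1, r2, r3⟩ : ∃ r, 0 < r ∧ r ≤ ρ ∧ x + r < s - r ∧ s + r < y - r ∧
      y + r < t - r := by
    have hg : 0 < min (s - x) (min (y - s) (t - y)) / 4 := by
      have : 0 < min (s - x) (min (y - s) (t - y)) :=
        lt_min (by linarith) (lt_min (by linarith) (by linarith))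
      positivity
    have g1 := min_le_left (s - x) (min (y - s) (t - y))
    have g2 := (min_le_right (s - x) (min (y - s) (t - y))).trans (min_le_left _ _)
    have g3 := (min_le_right (s - x) (min (y - s) (t - y))).trans (min_le_right _ _)
    have g4 := min_le_right ρ (min (s - x) (min (y - s) (t - y)) / 4)
    exact ⟨min ρ (min (s - x) (min (y - s) (t - y)) / 4), lt_min hρ hg, min_le_left _ _,
      by linarith, by linarith, by linarith⟩
  have hbox : ∀ {A : ℝ × ℝ}, ‖A‖ < r → (-r < A.1 ∧ A.1 < r) ∧ (-r < A.2 ∧ A.2 < r) := fun hA =>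
    ⟨abs_lt.1 ((norm_fst_le _).trans_lt hA), abs_lt.1 ((norm_snd_le _).trans_lt hA)⟩
  have hclose : ∀ {A B : ℝ × ℝ}, ‖A‖ < r → ‖B‖ < r →
      |H (A, B) - H 0| < ε / 14 ∧ |K (A, B) - K 0| < ε / 14 := fun hA hB => by
    have := hball (y := (_, _)) (by
      rw [dist_zero_right, Prod.norm_def]; exact (max_lt hA hB).trans_le hrρ)
    simpa only [Real.dist_eq] using this
  have h0 : c.logCross x y s t = 0 := by
    rw [c.logCross_eq_zero_iff h1 h2 h3, ← hqx, ← hqy, ← hqz, ← hqu]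
    exact q.harm
  have hloop := exists_zz_of_hasSmallLoop (η := ε / 7) (by positivity)
    (P := fun q A B => ‖A‖ < r ∧ ‖B‖ < r ∧ q.x = c.e (x - A.1) ∧ q.y = c.e (y - A.2) ∧
      q.z = c.e (s + B.1) ∧ q.u = c.e (t + B.2)) ?_ ?_ ?_ (c.hasSmallLoop_logCross hr r1 r2 r3 h0)
    (q₀ := q) ⟨by rwa [norm_zero], by rwa [norm_zero], by simpa using hqx, by simpa using hqy,
      by simpa using hqz, by simpa using hqu⟩
  · obtain ⟨b, n, l, hl, hz⟩ := hloop
    exact ⟨b, n, l, by linarith, hz⟩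
  · intro A B hA hB hO
    have bA := hbox hA
    have bB := hbox hB
    exact ⟨⟨c.e (x - A.1), c.e (y - A.2), c.e (s + B.1), c.e (t + B.2),
      c.e_ne (by linarith : x - A.1 < y - A.2).ne, c.e_ne (by linarith : x - A.1 < s + B.1).ne,
      c.e_ne (by linarith : x - A.1 < t + B.2).ne, c.e_ne (by linarith : s + B.1 < y - A.2).ne',
      c.e_ne (by linarith : y - A.2 < t + B.2).ne, c.e_ne (by linarith : s + B.1 < t + B.2).ne,
      (c.logCross_eq_zero_iff (by linarith) (by linarith) (by linarith)).1 hO⟩,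
      hA, hB, rfl, rfl, rfl, rfl⟩
  · rintro q q' A B B' ⟨hA, hB, e1, e2, e3, e4⟩ ⟨-, hB', f1, f2, f3, f4⟩
    have bB := hbox hB
    have bB' := hbox hB'
    refine ⟨Or.inl ⟨e1.trans f1.symm, e2.trans f2.symm⟩, ?_, ?_⟩
    · rw [stepDistL, M.lineDist_eq_remote (ω := ω) q.hxy q.hxz q.hyz
        (by rw [e1, ← f1]; exact q'.hxz) (by rw [e2, ← f2]; exact q'.hyz)
        (by rw [e1]; exact c.ne _) (by rw [e2]; exact c.ne _) (by rw [e3]; exact c.ne _)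
        (by rw [f3]; exact c.ne _), e1, e2, e3, f3]
      change |H (A, B) - H (A, B')| ≤ ε / 7
      have k1 := abs_lt.1 (hclose hA hB).1
      have k2 := abs_lt.1 (hclose hA hB').1
      rw [abs_le]
      constructor <;> linarith
    · rintro hne (⟨k1, k2⟩ | ⟨k1, -⟩)
      · rw [e3, f3] at k1
        rw [e4, f4] at k2
        exact hne (Prod.ext (add_left_cancel (c.inj k1)) (add_left_cancel (c.inj k2)))
      · rw [e3, f4] at k1
        linarith [c.inj k1]
  · rintro q q' A A' B ⟨hA, hB, e1, e2, e3, e4⟩ ⟨hA', -, f1, f2, f3, f4⟩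
    have bA := hbox hA
    have bA' := hbox hA'
    refine ⟨Or.inl ⟨e3.trans f3.symm, e4.trans f4.symm⟩, ?_, ?_⟩
    · rw [stepDistR, M.lineDist_eq_remote (ω := ω) q.hzu q.hxz.symm q.hxu.symm
        (by rw [e3, ← f3]; exact q'.hxz.symm) (by rw [e4, ← f4]; exact q'.hxu.symm)
        (by rw [e3]; exact c.ne _) (by rw [e4]; exact c.ne _) (by rw [e1]; exact c.ne _)
        (by rw [f1]; exact c.ne _), e1, e3, e4, f1]
      change |K (A, B) - K (A', B)| ≤ ε / 7
      have k1 := abs_lt.1 (hclose hA hB).2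
      have k2 := abs_lt.1 (hclose hA' hB).2
      rw [abs_le]
      constructor <;> linarith
    · rintro hne (⟨k1, k2⟩ | ⟨k1, -⟩)
      · rw [e1, f1] at k1
        rw [e2, f2] at k2
        exact hne (Prod.ext (sub_right_injective (c.inj k1)) (sub_right_injective (c.inj k2)))
      · rw [e1, f2] at k1
        linarith [c.inj k1]

end MobiusChart

theorem HarmPt.exists_separated_chart (q : HarmPt M) : ∃ (ω : X) (c : MobiusChart M ω)
    (x y s t : ℝ) (q' : HarmPt M), x < s ∧ s < y ∧ y < t ∧ q'.x = c.e x ∧ q'.y = c.e y ∧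
      q'.z = c.e s ∧ q'.u = c.e t ∧ leftAxisEq q q' ∧ rightAxisEq q q' := by
  obtain ⟨ω, h1, h2, h3, h4⟩ := M.exists_ne_of_four q.x q.y q.z q.u
  obtain ⟨c⟩ := M.nonempty_chart ω
  obtain ⟨x, y, q₁, hxy, ex, ey, l1, r1⟩ : ∃ (x y : ℝ) (q₁ : HarmPt M), x < y ∧ q₁.x = c.e x ∧
      q₁.y = c.e y ∧ leftAxisEq q q₁ ∧ (q.z = q₁.z ∧ q.u = q₁.u) := by
    obtain ⟨x, hx⟩ := c.surj _ h1.symm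
    obtain ⟨y, hy⟩ := c.surj _ h2.symm
    rcases lt_or_gt_of_ne (fun h => q.hxy (by rw [← hx, ← hy, h]) : x ≠ y) with h | h
    · exact ⟨x, y, q, h, hx.symm, hy.symm, leftAxisEq.refl q, rfl, rfl⟩
    · exact ⟨y, x, ⟨q.y, q.x, q.z, q.u, q.hxy.symm, q.hyz, q.hyu, q.hxz, q.hxu, q.hzu,
        MonotoneMobius.Harmonic.swap_left M q.harm⟩, h, hy.symm, hx.symm, Or.inr ⟨rfl, rfl⟩,
        rfl, rfl⟩
  obtain ⟨s, t, q₂, hst, fx, fy, fs, ft, l2, r2⟩ : ∃ (s t : ℝ) (q₂ : HarmPt M), s < t ∧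
      q₂.x = c.e x ∧ q₂.y = c.e y ∧ q₂.z = c.e s ∧ q₂.u = c.e t ∧ leftAxisEq q q₂ ∧
      rightAxisEq q q₂ := by
    obtain ⟨s, hs⟩ := c.surj _ h3.symm
    obtain ⟨t, ht⟩ := c.surj _ h4.symm
    rcases lt_or_gt_of_ne (fun h => q.hzu (by rw [← hs, ← ht, h]) : s ≠ t) with h | h
    · exact ⟨s, t, q₁, h, ex, ey, by rw [← r1.1, hs], by rw [← r1.2, ht], l1, Or.inl r1⟩
    · exact ⟨t, s, ⟨q₁.x, q₁.y, q₁.u, q₁.z, q₁.hxy, q₁.hxu, q₁.hxz, q₁.hyu, q₁.hyz, q₁.hzu.symm,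
        MonotoneMobius.Harmonic.swap_right M q₁.harm⟩, h, ex, ey,
        r1.2.symm.trans ht.symm, r1.1.symm.trans hs.symm, l1, Or.inr r1⟩
  rcases c.separated_of_harmonic hxy hst (fun h => q₂.hxz (by rw [fx, fs, h]))
    (fun h => q₂.hxu (by rw [fx, ft, h])) (fun h => q₂.hyz (by rw [fy, fs, h]))
    (fun h => q₂.hyu (by rw [fy, ft, h])) (by rw [← fx, ← fy, ← fs, ← ft]; exact q₂.harm) with
    ⟨k1, k2, k3⟩ | ⟨k1, k2, k3⟩
  · exact ⟨ω, c, x, y, s, t, q₂, k1, k2, k3, fx, fy, fs, ft, l2, r2⟩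
  · refine ⟨ω, c.neg, -y, -x, -t, -s, ⟨q₂.y, q₂.x, q₂.u, q₂.z, q₂.hxy.symm, q₂.hyu, q₂.hyz, q₂.hxu,
      q₂.hxz, q₂.hzu.symm, MonotoneMobius.Harmonic.swap_right M
        (MonotoneMobius.Harmonic.swap_left M q₂.harm)⟩, by linarith, by linarith, by linarith,
      ?_, ?_, ?_, ?_, l2.trans (Or.inr ⟨rfl, rfl⟩), r2.trans (Or.inr ⟨rfl, rfl⟩)⟩
    all_goals simpa only [MobiusChart.neg, neg_neg]

theorem HarmPt.exists_zz_le (q q' : HarmPt M) (hl : leftAxisEq q q') (hr : rightAxisEq q q')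
    (ε : ℝ) (hε : 0 < ε) : ∃ b n l, l ≤ ε ∧ ZZ q q' b n l := by
  obtain ⟨ω, c, x, y, s, t, q₀, h1, h2, h3, e1, e2, e3, e4, l0, r0⟩ := q.exists_separated_chart
  obtain ⟨b, n, l, hle, hz⟩ := c.exists_small_loop h1 h2 h3 e1 e2 e3 e4 hε
  exact ⟨b, n + 1, l, hle,
    (hz.congr_start l0.symm r0.symm).congr_end (l0.symm.trans hl) (r0.symm.trans hr)⟩

end Loops

/-- The zig-zag distance `δ` on `Harm` is a pseudometric: it is symmetric,
`δ(q,q) = 0`, it satisfies the triangle inequality, and it is finite for all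
`q, q', q'' ∈ Harm`. -/
theorem stmt15 {X : Type*} [CircularOrder X] [TopologicalSpace X]
    {M : MonotoneMobius X} :
    (∀ q q' : HarmPt M, zzDist q q' = zzDist q' q) ∧
    (∀ q : HarmPt M, zzDist q q = 0) ∧
    (∀ q q' q'' : HarmPt M, zzDist q q'' ≤ zzDist q q' + zzDist q' q'') ∧
    (∀ q q' : HarmPt M, zzDist q q' < ⊤) := by
  exact zzDist_pseudometric HarmPt.exists_zz_le HarmPt.exists_joinedWithin
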